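/- (Theorem 2.4, self-decomposability.) Let α > 0 and assume either m ≥ 0, or m < 0 and θ < α. Then there exist a ≥ 0 and a nonincreasing function k : (0,∞) → [0,∞) with ∫₀^∞ min(1,r)·(k(r)/r) dr < ∞ such that for all q ≥ 0: 1 / I_{α,ψ}(q) = exp( −( a·q + ∫₀^∞ (1 − e^{−q·r})·(k(r)/r) dr ) ). In other words, q ↦ 1/I_{α,ψ}(q) is the Laplace transform of a self-decomposable probability distribution on [0,∞). -/

import Mathlib

open MeasureTheory Real Set Filter Topology

/-- The Laplace exponent of a spectrally negative infinitely divisible random variable. -/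
noncomputable def psi (σ b : ℝ) (ν : Measure ℝ) (u : ℝ) : ℝ :=
  b * u + σ / 2 * u ^ 2 +
    ∫ r in Ioi (0 : ℝ), (Real.exp (-u * r) - 1 + (if r ≤ 1 then u * r else 0)) ∂ν

/-- The coefficients `a_n(ψ;α) = (∏_{k=1}^n ψ(αk))⁻¹`, with `a_0 = 1`. -/
noncomputable def coeffA (ψ : ℝ → ℝ) (α : ℝ) (n : ℕ) : ℝ :=
  (∏ k ∈ Finset.range n, ψ (α * (k + 1)))⁻¹

/-- The power series `I_{α,ψ}(x) = Σ_{n≥0} a_n(ψ;α) x^n`. -/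
noncomputable def Iser (ψ : ℝ → ℝ) (α : ℝ) (x : ℝ) : ℝ :=
  ∑' n : ℕ, coeffA ψ α n * x ^ n

/-- The Lévy–Khintchine kernel `(1 - x ^ q) / (1 - x)`, continuously extended to `x = 1`. -/
noncomputable def lkKernel (q : NNReal) (x : ℝ) : ℝ :=
  dslope (fun y : ℝ => y ^ (q : ℝ)) 1 x

lemma lkKernel_one (q : NNReal) : lkKernel q 1 = q := by
  simp [lkKernel]

lemma lkKernel_of_ne (q : NNReal) {x : ℝ} (hx : x ≠ 1) :
    lkKernel q x = (1 - x ^ (q : ℝ)) / (1 - x) := by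
  rw [lkKernel, dslope_of_ne _ hx, slope_def_field, one_rpow, ← neg_div_neg_eq]
  ring

lemma continuous_lkKernel (q : NNReal) : Continuous (lkKernel q) := by
  refine continuous_iff_continuousAt.2 fun x => ?_
  rcases eq_or_ne x 1 with rfl | hx
  · exact continuousAt_dslope_same.2
      (hasDerivAt_rpow_const (Or.inl one_ne_zero)).differentiableAt
  · exact (continuousAt_dslope_of_ne hx).2 (continuousAt_rpow_const _ _ (Or.inr q.2))

lemma lkKernel_nonneg (q : NNReal) {x : ℝ} (h0 : 0 ≤ x) (h1 : x ≤ 1) : 0 ≤ lkKernel q x := by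
  rcases eq_or_ne x 1 with rfl | hx
  · rw [lkKernel_one]; exact q.2
  · rw [lkKernel_of_ne q hx]
    exact div_nonneg (sub_nonneg.2 (rpow_le_one h0 h1 q.2)) (sub_nonneg.2 h1)

lemma lkKernel_at_one (x : ℝ) : lkKernel 1 x = 1 := by
  rcases eq_or_ne x 1 with rfl | hx
  · simp [lkKernel_one]
  · rw [lkKernel_of_ne 1 hx]
    have : 1 - x ≠ 0 := sub_ne_zero.2 hx.symm
    simp [this]

lemma one_sub_mul_lkKernel (q : NNReal) (x : ℝ) :
    (1 - x) * lkKernel q x = 1 - x ^ (q : ℝ) := by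
  rcases eq_or_ne x 1 with rfl | hx
  · simp
  · rw [lkKernel_of_ne q hx]
    have : 1 - x ≠ 0 := sub_ne_zero.2 hx.symm
    field_simp

/-- The kernel as a bounded continuous function on `[0, 1]`. -/
noncomputable def lkKernelBCF (q : NNReal) : BoundedContinuousFunction unitInterval ℝ :=
  BoundedContinuousFunction.mkOfCompact
    ⟨fun x => lkKernel q x, (continuous_lkKernel q).comp continuous_subtype_val⟩

/-- The Bernstein functions without killing term, up to a jump at `0`. -/
def bernsteinCone : Set (NNReal → ℝ) :=
  {f | ∃ M : FiniteMeasure unitInterval, ∀ q, f q = ∫ x, lkKernel q x ∂(M : Measure unitInterval)}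

lemma integrable_lkKernel (q : NNReal) (M : FiniteMeasure unitInterval) :
    Integrable (fun x : unitInterval => lkKernel q x) (M : Measure unitInterval) :=
  (lkKernelBCF q).integrable _

lemma bernsteinCone_zero_mem : (0 : NNReal → ℝ) ∈ bernsteinCone :=
  ⟨0, fun q => by simp⟩

lemma bernsteinCone_add_mem {f g : NNReal → ℝ} (hf : f ∈ bernsteinCone)
    (hg : g ∈ bernsteinCone) : f + g ∈ bernsteinCone := by
  obtain ⟨M, hM⟩ := hf
  obtain ⟨N, hN⟩ := hg
  refine ⟨M + N, fun q => ?_⟩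
  rw [FiniteMeasure.toMeasure_add, integral_add_measure (integrable_lkKernel q M)
    (integrable_lkKernel q N), Pi.add_apply, hM, hN]

lemma bernsteinCone_smul_mem {f : NNReal → ℝ} (hf : f ∈ bernsteinCone) (c : NNReal) :
    (fun q => (c : ℝ) * f q) ∈ bernsteinCone := by
  obtain ⟨M, hM⟩ := hf
  refine ⟨c • M, fun q => ?_⟩
  rw [FiniteMeasure.toMeasure_smul, integral_smul_nnreal_measure, ← hM]
  rfl

lemma bernsteinCone_exp_mem {c r : ℝ} (hc : 0 ≤ c) (hr : 0 ≤ r) :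
    (fun q : NNReal => c - c * exp (-r * q)) ∈ bernsteinCone := by
  have hx0 : 0 ≤ exp (-r) := (exp_pos _).le
  have hx1 : exp (-r) ≤ 1 := exp_le_one_iff.2 (by linarith)
  let x : unitInterval := ⟨exp (-r), hx0, hx1⟩
  refine ⟨⟨(Real.toNNReal (c * (1 - exp (-r)))) • Measure.dirac x, inferInstance⟩, fun q => ?_⟩
  simp only [FiniteMeasure.toMeasure_mk]
  rw [integral_smul_nnreal_measure, integral_dirac]
  change _ = (Real.toNNReal (c * (1 - exp (-r))) : ℝ) * lkKernel q (exp (-r))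
  rw [Real.coe_toNNReal _ (mul_nonneg hc (sub_nonneg.2 hx1)), mul_assoc, one_sub_mul_lkKernel,
    ← exp_mul]
  ring

lemma isClosed_bernsteinCone : IsClosed bernsteinCone := by
  refine closure_subset_iff_isClosed.1 fun f hf => ?_
  let C : NNReal := Real.toNNReal (f 1) + 1
  have hC : f 1 < C := by
    have := Real.le_coe_toNNReal (f 1)
    simp only [C, NNReal.coe_add, NNReal.coe_one]
    linarith
  let Φ : FiniteMeasure unitInterval → (NNReal → ℝ) :=
    fun M q => ∫ x, lkKernel q x ∂(M : Measure unitInterval)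
  have hΦ : Continuous Φ := continuous_pi fun q =>
    FiniteMeasure.continuous_integral_boundedContinuousFunction (lkKernelBCF q)
  have hcl : IsClosed (Φ '' {M | M.mass ≤ C}) :=
    ((isCompact_setOfPred_finiteMeasure_le_of_compactSpace unitInterval C).image hΦ).isClosed
  have hU : IsOpen {g : NNReal → ℝ | g 1 < C} := isOpen_lt (continuous_apply 1) continuous_const
  have hsub : {g : NNReal → ℝ | g 1 < C} ∩ bernsteinCone ⊆ Φ '' {M | M.mass ≤ C} := by
    rintro g ⟨hg, M, hM⟩
    refine ⟨M, ?_, (funext hM).symm⟩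
    have h1 := hM 1
    simp only [lkKernel_at_one, integral_const, smul_eq_mul, mul_one] at h1
    have h2 : g 1 = (M.mass : ℝ) := h1
    simp only [mem_ofPred_eq] at hg ⊢
    rw [h2] at hg
    exact_mod_cast hg.le
  obtain ⟨M, -, hM⟩ := closure_minimal hsub hcl (hU.inter_closure ⟨hC, hf⟩)
  exact ⟨M, fun q => (congrFun hM q).symm⟩

/-- The functions `q ↦ c * exp (-r * q)` with `c, r ≥ 0`. -/
def expMonomials : Set (NNReal → ℝ) :=
  {f | ∃ c r : ℝ, 0 ≤ c ∧ 0 ≤ r ∧ f = fun q : NNReal => c * exp (-r * q)}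

/-- The completely monotone functions: the closed semiring generated by decreasing
exponentials. -/
noncomputable def cmSemiring : Subsemiring (NNReal → ℝ) :=
  (Subsemiring.closure expMonomials).topologicalClosure

lemma isClosed_cmSemiring : IsClosed (cmSemiring : Set (NNReal → ℝ)) :=
  Subsemiring.isClosed_topologicalClosure _

lemma exp_mem_cmSemiring {c r : ℝ} (hc : 0 ≤ c) (hr : 0 ≤ r) :
    (fun q : NNReal => c * exp (-r * q)) ∈ cmSemiring :=
  Subsemiring.le_topologicalClosure _ (Subsemiring.subset_closure ⟨c, r, hc, hr, rfl⟩)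

lemma const_mem_cmSemiring {c : ℝ} (hc : 0 ≤ c) : (fun _ : NNReal => c) ∈ cmSemiring := by
  simpa using exp_mem_cmSemiring hc le_rfl

lemma nonneg_of_mem_cmSemiring {f : NNReal → ℝ} (hf : f ∈ cmSemiring) (q : NNReal) :
    0 ≤ f q := by
  have hcl : IsClosed {f : NNReal → ℝ | 0 ≤ f q} := isClosed_le continuous_const (continuous_apply q)
  refine closure_minimal (s := (Subsemiring.closure expMonomials : Set (NNReal → ℝ)))
    (fun g hg => ?_) hcl hf
  induction hg using Subsemiring.closure_induction with
  | mem g hg =>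
    obtain ⟨c, r, hc, hr, rfl⟩ := hg
    exact mul_nonneg hc (exp_pos _).le
  | zero => simp
  | one => simp
  | add f g _ _ hf hg => exact add_nonneg (show 0 ≤ f q from hf) (show 0 ≤ g q from hg)
  | mul f g _ _ hf hg => exact mul_nonneg (show 0 ≤ f q from hf) (show 0 ≤ g q from hg)

lemma comp_mul_mem_cmSemiring {f : NNReal → ℝ} (hf : f ∈ cmSemiring) (s : NNReal) :
    (fun q => f (s * q)) ∈ cmSemiring := by
  have hcont : Continuous fun (g : NNReal → ℝ) (q : NNReal) => g (s * q) :=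
    continuous_pi fun q => continuous_apply _
  refine closure_minimal (s := (Subsemiring.closure expMonomials : Set (NNReal → ℝ)))
    (fun g hg => ?_) (isClosed_cmSemiring.preimage hcont) hf
  change (fun q => g (s * q)) ∈ cmSemiring
  induction hg using Subsemiring.closure_induction with
  | mem g hg =>
    obtain ⟨c, r, hc, hr, rfl⟩ := hg
    have := exp_mem_cmSemiring hc (mul_nonneg hr s.2)
    simpa [mul_assoc] using this
  | zero => exact zero_mem _
  | one => exact one_mem _
  | add f g _ _ hf hg => exact add_mem hf hg
  | mul f g _ _ hf hg => exact mul_mem hf hg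

lemma submonoidClosure_expMonomials_subset :
    (Submonoid.closure expMonomials : Set (NNReal → ℝ)) ⊆ expMonomials := by
  intro f hf
  induction hf using Submonoid.closure_induction with
  | mem f hf => exact hf
  | one => exact ⟨1, 0, zero_le_one, le_rfl, by ext; simp⟩
  | mul f g _ _ hf hg =>
    obtain ⟨c, r, hc, hr, rfl⟩ := hf
    obtain ⟨d, t, hd, ht, rfl⟩ := hg
    refine ⟨c * d, r + t, mul_nonneg hc hd, add_nonneg hr ht, ?_⟩
    ext q
    have : -(r + t) * (q : ℝ) = -r * q + -t * q := by ring
    simp only [Pi.mul_apply, this, exp_add]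
    ring

lemma sub_mem_bernsteinCone_of_mem_cmSemiring {f : NNReal → ℝ} (hf : f ∈ cmSemiring) :
    (fun q => f 0 - f q) ∈ bernsteinCone := by
  have hcont : Continuous fun (g : NNReal → ℝ) (q : NNReal) => g 0 - g q :=
    continuous_pi fun q => (continuous_apply 0).sub (continuous_apply q)
  refine closure_minimal (s := (Subsemiring.closure expMonomials : Set (NNReal → ℝ)))
    (fun g hg => ?_) (isClosed_bernsteinCone.preimage hcont) hf
  change (fun q => g 0 - g q) ∈ bernsteinCone
  rw [SetLike.mem_coe, Subsemiring.mem_closure_iff] at hg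
  induction hg using AddSubmonoid.closure_induction with
  | mem g hg =>
    obtain ⟨c, r, hc, hr, rfl⟩ := submonoidClosure_expMonomials_subset hg
    simpa using bernsteinCone_exp_mem hc hr
  | zero => simpa using! bernsteinCone_zero_mem
  | add f g _ _ hf hg =>
    convert! bernsteinCone_add_mem hf hg using 1
    ext q
    simp only [Pi.add_apply]
    ring

lemma mem_cmSemiring_of_hasSum {ι : Type*} {F : ι → NNReal → ℝ} {f : NNReal → ℝ}
    (hF : ∀ i, F i ∈ cmSemiring) (h : ∀ q, HasSum (fun i => F i q) (f q)) : f ∈ cmSemiring := by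
  have h' : HasSum F f := Pi.hasSum.2 h
  exact isClosed_cmSemiring.mem_of_tendsto h' (Eventually.of_forall fun s =>
    sum_mem fun i _ => hF i)

lemma tendsto_div_one_sub_exp {x : ℝ} (hx : 0 < x) :
    Tendsto (fun h : ℝ => h / (1 - exp (-h * x))) (𝓝[≠] 0) (𝓝 (1 / x)) := by
  have h1 : HasDerivAt (fun h : ℝ => 1 - exp (-h * x)) x 0 := by
    have h2 : HasDerivAt (fun h : ℝ => -h * x) (-1 * x) 0 := (hasDerivAt_id 0).neg.mul_const x
    simpa using (h2.exp.const_sub 1)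
  have h3 := (hasDerivAt_iff_tendsto_slope.1 h1).inv₀ hx.ne'
  rw [one_div]
  refine h3.congr fun h => ?_
  simp [slope_def_field]

lemma inv_affine_mem_cmSemiring {B s : ℝ} (hB : 0 < B) (hs : 0 ≤ s) :
    (fun q : NNReal => 1 / (B + s * q)) ∈ cmSemiring := by
  have hpos : ∀ q : NNReal, 0 < B + s * q := fun q =>
    add_pos_of_pos_of_nonneg hB (mul_nonneg hs q.2)
  have hmem : ∀ h : ℝ, 0 < h →
      (fun q : NNReal => h / (1 - exp (-h * (B + s * q)))) ∈ cmSemiring := by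
    intro h hh
    refine mem_cmSemiring_of_hasSum (F := fun (n : ℕ) (q : NNReal) =>
      (h * exp (-h * B) ^ n) * exp (-(h * s * n) * q))
      (fun n => exp_mem_cmSemiring (by positivity) (by positivity)) fun q => ?_
    have hlt : exp (-h * (B + s * q)) < 1 := by
      rw [exp_lt_one_iff]
      nlinarith [mul_pos hh (hpos q)]
    have h1 := (hasSum_geometric_of_lt_one (exp_pos _).le hlt).mul_left h
    rw [div_eq_mul_inv]
    convert! h1 using 2 with n
    rw [mul_assoc, ← exp_nat_mul, ← exp_nat_mul, ← exp_add]
    ring_nf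
  have hlim : Tendsto (fun (h : ℝ) (q : NNReal) => h / (1 - exp (-h * (B + s * q))))
      (𝓝[>] 0) (𝓝 fun q : NNReal => 1 / (B + s * q)) :=
    tendsto_pi_nhds.2 fun q => (tendsto_div_one_sub_exp (hpos q)).mono_left
      (nhdsWithin_mono _ fun x hx => ne_of_gt hx)
  exact isClosed_cmSemiring.mem_of_tendsto hlim
    (eventually_nhdsWithin_of_forall fun h hh => hmem h hh)

lemma div_sub_mem_cmSemiring {f : NNReal → ℝ} (hf : f ∈ cmSemiring) {l B c s : ℝ} (hl : 0 ≤ l)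
    (hc : c < B) (hs : 0 ≤ s) (hfc : ∀ q, f q ≤ c) :
    (fun q : NNReal => l / (B + s * q - f q)) ∈ cmSemiring := by
  have hf0 := nonneg_of_mem_cmSemiring hf
  have hB : 0 < B := ((hf0 0).trans (hfc 0)).trans_lt hc
  refine mem_cmSemiring_of_hasSum (F := fun (n : ℕ) => (fun _ : NNReal => l) *
    (fun q : NNReal => 1 / (B + s * q)) * (f * fun q : NNReal => 1 / (B + s * q)) ^ n)
    (fun n => mul_mem (mul_mem (const_mem_cmSemiring hl) (inv_affine_mem_cmSemiring hB hs))
      (pow_mem (mul_mem hf (inv_affine_mem_cmSemiring hB hs)) n)) fun q => ?_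
  have hpos : 0 < B + s * q := add_pos_of_pos_of_nonneg hB (mul_nonneg hs q.2)
  have hfq : f q < B + s * q := by
    have : 0 ≤ s * (q : ℝ) := mul_nonneg hs q.2
    linarith [hfc q]
  have h1 := (hasSum_geometric_of_lt_one (r := f q * (1 / (B + s * q)))
    (mul_nonneg (hf0 q) (by positivity)) (by rw [mul_one_div, div_lt_one hpos]; exact hfq)).mul_left
    (l * (1 / (B + s * q)))
  convert! h1 using 1
  have : B + s * q - f q ≠ 0 := by linarith
  have h3 : 1 - f q * (1 / (B + s * q)) ≠ 0 := by
    rw [mul_one_div, one_sub_div hpos.ne']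
    exact div_ne_zero this hpos.ne'
  field_simp

/-- The coefficients `(∏_{k < n} p k)⁻¹`. -/
noncomputable def recipProd (p : ℕ → ℝ) (n : ℕ) : ℝ := (∏ k ∈ Finset.range n, p k)⁻¹

/-- The power series with coefficients `recipProd p`. -/
noncomputable def recipSeries (p : ℕ → ℝ) (x : ℝ) : ℝ := ∑' n : ℕ, recipProd p n * x ^ n

/-- Positive sequences growing at least linearly, as do the values of a convex function vanishing
at zero along an arithmetic progression. -/
structure LinGrowth (p : ℕ → ℝ) : Prop where
  pos_zero : 0 < p 0
  le : ∀ k : ℕ, (k + 1) * p 0 ≤ p k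

lemma LinGrowth.pos {p : ℕ → ℝ} (hp : LinGrowth p) (k : ℕ) : 0 < p k :=
  (mul_pos (by positivity) hp.pos_zero).trans_le (hp.le k)

lemma recipProd_zero (p : ℕ → ℝ) : recipProd p 0 = 1 := by simp [recipProd]

lemma recipProd_succ (p : ℕ → ℝ) (n : ℕ) : recipProd p (n + 1) = recipProd p n * (p n)⁻¹ := by
  simp [recipProd, Finset.prod_range_succ, mul_comm]

lemma recipProd_pos {p : ℕ → ℝ} (hp : LinGrowth p) (n : ℕ) : 0 < recipProd p n :=
  inv_pos.2 (Finset.prod_pos fun k _ => hp.pos k)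

lemma recipProd_le {p : ℕ → ℝ} (hp : LinGrowth p) {c : ℝ} (hc : 0 < c) (hcp : c ≤ p 0) (n : ℕ) :
    recipProd p n ≤ c⁻¹ ^ n / n.factorial := by
  induction n with
  | zero => simp [recipProd_zero]
  | succ n ih =>
    have h1 : (n + 1) * c ≤ p n :=
      (mul_le_mul_of_nonneg_left hcp (by positivity)).trans (hp.le n)
    have h2 : (p n)⁻¹ ≤ ((n + 1) * c)⁻¹ := inv_anti₀ (by positivity) h1
    rw [recipProd_succ]
    calc recipProd p n * (p n)⁻¹ ≤ (c⁻¹ ^ n / n.factorial) * ((n + 1) * c)⁻¹ :=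
          mul_le_mul ih h2 (inv_nonneg.2 (hp.pos n).le) (by positivity)
      _ = c⁻¹ ^ (n + 1) / (n + 1).factorial := by
          rw [Nat.factorial_succ, pow_succ]
          push_cast
          field_simp

lemma norm_weighted_recipProd_le {p : ℕ → ℝ} (hp : LinGrowth p) {c : ℝ} (hc : 0 < c)
    (hcp : c ≤ p 0) {w x : ℝ} (n : ℕ) (hw : |w| ≤ 2 ^ n) :
    ‖w * (recipProd p n * x ^ n)‖ ≤ (2 * c⁻¹ * |x|) ^ n / n.factorial := by
  rw [norm_eq_abs, abs_mul, abs_mul, abs_of_pos (recipProd_pos hp n), abs_pow]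
  calc |w| * (recipProd p n * |x| ^ n) ≤ 2 ^ n * ((c⁻¹ ^ n / n.factorial) * |x| ^ n) := by
        gcongr
        · exact mul_nonneg (recipProd_pos hp n).le (by positivity)
        · exact recipProd_le hp hc hcp n
    _ = _ := by rw [mul_pow, mul_pow]; ring

lemma summable_weighted_recipProd {p : ℕ → ℝ} (hp : LinGrowth p) {w : ℕ → ℝ}
    (hw : ∀ n, |w n| ≤ 2 ^ n) (x : ℝ) : Summable fun n => w n * (recipProd p n * x ^ n) :=
  Summable.of_norm_bounded (Real.summable_pow_div_factorial _) fun n =>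
    norm_weighted_recipProd_le hp hp.pos_zero le_rfl n (hw n)

lemma hasSum_recipSeries {p : ℕ → ℝ} (hp : LinGrowth p) (x : ℝ) :
    HasSum (fun n => recipProd p n * x ^ n) (recipSeries p x) := by
  have := summable_weighted_recipProd hp (w := fun _ => 1)
    (fun n => by simpa using one_le_pow₀ (one_le_two (α := ℝ))) x
  simp only [one_mul] at this
  exact this.hasSum

lemma one_le_recipSeries {p : ℕ → ℝ} (hp : LinGrowth p) {x : ℝ} (hx : 0 ≤ x) :
    1 ≤ recipSeries p x := by
  have := (hasSum_recipSeries hp x).summable.le_tsum 0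
    (fun n _ => mul_nonneg (recipProd_pos hp n).le (pow_nonneg hx n))
  simpa [recipProd_zero, recipSeries] using this

lemma recipSeries_zero (p : ℕ → ℝ) : recipSeries p 0 = 1 := by
  rw [recipSeries, tsum_eq_single 0]
  · simp [recipProd_zero]
  · intro n hn
    simp [hn]

lemma recipSeries_mono {p : ℕ → ℝ} (hp : LinGrowth p) {x y : ℝ} (hx : 0 ≤ x) (hxy : x ≤ y) :
    recipSeries p x ≤ recipSeries p y :=
  hasSum_le (fun n => mul_le_mul_of_nonneg_left (pow_le_pow_left₀ hx hxy n) (recipProd_pos hp n).le)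
    (hasSum_recipSeries hp x) (hasSum_recipSeries hp y)

lemma LinGrowth.mono_zero {p : ℕ → ℝ} (hp : LinGrowth p) (k : ℕ) : p 0 ≤ p k := by
  have := hp.le k
  nlinarith [hp.pos_zero, (Nat.cast_nonneg k : (0:ℝ) ≤ k)]

lemma recipSeries_sub_one_le {p : ℕ → ℝ} (hp : LinGrowth p) {x : ℝ} (hx : 0 ≤ x) :
    recipSeries p x - 1 ≤ (p 0)⁻¹ * x * recipSeries p x := by
  have h1 := (hasSum_nat_add_iff' 1).2 (hasSum_recipSeries hp x)
  have h2 := (hasSum_recipSeries hp x).mul_left ((p 0)⁻¹ * x)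
  simp only [Finset.sum_range_one, recipProd_zero, pow_zero, mul_one] at h1
  refine hasSum_le (fun n => ?_) h1 h2
  rw [recipProd_succ, pow_succ]
  have : (p n)⁻¹ ≤ (p 0)⁻¹ := inv_anti₀ hp.pos_zero (hp.mono_zero n)
  have h3 : 0 ≤ recipProd p n * x ^ n * x :=
    mul_nonneg (mul_nonneg (recipProd_pos hp n).le (pow_nonneg hx n)) hx
  nlinarith [mul_le_mul_of_nonneg_left this h3]

lemma tendsto_weighted_recipSeries {ι : Type*} {l : Filter ι} {P : ι → ℕ → ℝ} {p : ℕ → ℝ}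
    (hP : ∀ᶠ i in l, LinGrowth (P i)) (hp : 0 < p 0)
    (hlim : ∀ k, Tendsto (fun i => P i k) l (𝓝 (p k))) (hppos : ∀ k, p k ≠ 0)
    {W : ι → ℕ → ℝ} {w : ℕ → ℝ} (hW : ∀ᶠ i in l, ∀ n, |W i n| ≤ 2 ^ n)
    (hWlim : ∀ n, Tendsto (fun i => W i n) l (𝓝 (w n))) (x : ℝ) :
    Tendsto (fun i => ∑' n, W i n * (recipProd (P i) n * x ^ n)) l
      (𝓝 (∑' n, w n * (recipProd p n * x ^ n))) := by
  refine tendsto_tsum_of_dominated_convergence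
    (Real.summable_pow_div_factorial (2 * (p 0 / 2)⁻¹ * |x|)) (fun n => ?_) ?_
  · refine (hWlim n).mul (Tendsto.mul_const _ ?_)
    exact (tendsto_finsetProd _ fun k _ => hlim k).inv₀ (Finset.prod_ne_zero_iff.2 fun k _ => hppos k)
  · filter_upwards [hP, hW, (hlim 0).eventually_const_le (half_lt_self hp)] with i h1 h2 h3 n
    exact norm_weighted_recipProd_le h1 (half_pos hp) h3 n (h2 n)

lemma LinGrowth.of_tendsto {ι : Type*} {l : Filter ι} [l.NeBot] {P : ι → ℕ → ℝ} {p : ℕ → ℝ}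
    (hP : ∀ᶠ i in l, ∀ k : ℕ, (k + 1) * P i 0 ≤ P i k) (hp : 0 < p 0)
    (hlim : ∀ k, Tendsto (fun i => P i k) l (𝓝 (p k))) : LinGrowth p :=
  ⟨hp, fun k => le_of_tendsto_of_tendsto ((hlim 0).const_mul _) (hlim k)
    (hP.mono fun _ h => h k)⟩

lemma integrable_of_abs_le_one {X : Type*} [MeasurableSpace X] (κ : Measure X) [IsFiniteMeasure κ]
    {f : X → ℝ} (hm : AEStronglyMeasurable f κ) (h : ∀ j, |f j| ≤ 1) : Integrable f κ :=
  (integrable_const (1 : ℝ)).mono' hm (Eventually.of_forall h)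

/-- The values `ψ (α * (k + 1))`, where `s = exp (-α * h)`, for the Laplace exponent `ψ` of a
compound Poisson process on the lattice of mesh `h`, jumping up by a single step at rate `l` and
down by `j` steps at rate `κ {j}`. -/
noncomputable def latticeExponent (l : ℝ) (s : NNReal) (κ : Measure ℕ) (k : ℕ) : ℝ :=
  l * ((s : ℝ)⁻¹ ^ (k + 1) - 1) - ∫ j, (1 - ((s : ℝ) ^ j) ^ (k + 1)) ∂κ

lemma prod_range_div_of_ne_zero {f : ℕ → ℝ} (hf : ∀ i, f i ≠ 0) (j : ℕ) :
    ∏ i ∈ Finset.range j, f (i + 1) / f i = f j / f 0 := by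
  induction j with
  | zero => simp [hf 0]
  | succ j ih =>
    rw [Finset.prod_range_succ, ih]
    have := hf j
    have := hf 0
    field_simp

section Lattice

variable {l : ℝ} {s : NNReal} {κ : Measure ℕ} [IsFiniteMeasure κ]

lemma abs_one_sub_pow_le (hs1 : s < 1) (j n : ℕ) : |1 - ((s : ℝ) ^ j) ^ n| ≤ 1 := by
  have h1 : ((s : ℝ) ^ j) ^ n ≤ 1 := pow_le_one₀ (by positivity) (pow_le_one₀ s.2 hs1.le)
  have h2 : 0 ≤ ((s : ℝ) ^ j) ^ n := by positivity
  rw [abs_le]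
  constructor <;> linarith

lemma integrable_one_sub_pow (hs1 : s < 1) (n : ℕ) :
    Integrable (fun j : ℕ => 1 - ((s : ℝ) ^ j) ^ n) κ :=
  integrable_of_abs_le_one κ (measurable_of_countable _).aestronglyMeasurable
    fun j => abs_one_sub_pow_le hs1 j n

lemma one_sub_pow_le_mul {y : ℝ} (h0 : 0 ≤ y) (n : ℕ) : 1 - y ^ n ≤ n * (1 - y) := by
  have := one_add_mul_le_pow (a := y - 1) (by linarith) n
  rw [add_sub_cancel] at this
  linarith

lemma latticeExponent_le (hl : 0 ≤ l) (hs0 : 0 < s) (hs1 : s < 1) (k : ℕ) :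
    (k + 1) * latticeExponent l s κ 0 ≤ latticeExponent l s κ k := by
  have h1 : (k + 1) * ((s : ℝ)⁻¹ - 1) ≤ (s : ℝ)⁻¹ ^ (k + 1) - 1 := by
    have hs' : 0 ≤ (s : ℝ)⁻¹ := by positivity
    have := one_add_mul_le_pow (a := (s : ℝ)⁻¹ - 1) (by linarith) (k + 1)
    rw [add_sub_cancel] at this
    push_cast at this
    linarith
  have h2 : ∫ j, (1 - ((s : ℝ) ^ j) ^ (k + 1)) ∂κ ≤
      ∫ j, (k + 1) * (1 - ((s : ℝ) ^ j) ^ (0 + 1)) ∂κ := by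
    refine integral_mono (integrable_one_sub_pow hs1 _)
      ((integrable_one_sub_pow hs1 _).const_mul _) fun j => ?_
    have := one_sub_pow_le_mul (y := (s : ℝ) ^ j) (by positivity) (k + 1)
    simpa using this
  rw [integral_const_mul] at h2
  simp only [latticeExponent]
  have h3 := mul_le_mul_of_nonneg_left h1 hl
  rw [zero_add, pow_one] at *
  nlinarith

lemma latticeExponent_linGrowth (hl : 0 ≤ l) (hs0 : 0 < s) (hs1 : s < 1)
    (hpos : 0 < latticeExponent l s κ 0) : LinGrowth (latticeExponent l s κ) :=
  ⟨hpos, latticeExponent_le hl hs0 hs1⟩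

lemma lattice_functional_eq (hp : LinGrowth (latticeExponent l s κ)) (hs0 : 0 < s) (hs1 : s < 1)
    {x : ℝ} (hx : 0 ≤ x) :
    l * (recipSeries (latticeExponent l s κ) ((s : ℝ)⁻¹ * x)
        - recipSeries (latticeExponent l s κ) x)
      - ∫ j, (recipSeries (latticeExponent l s κ) x
        - recipSeries (latticeExponent l s κ) ((s : ℝ) ^ j * x)) ∂κ
      = x * recipSeries (latticeExponent l s κ) x := by
  set p := latticeExponent l s κ with hpdef
  have hI := hasSum_recipSeries hp
  have hcf : ∀ n, 0 ≤ recipProd p n * x ^ n := fun n =>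
    mul_nonneg (recipProd_pos hp n).le (pow_nonneg hx n)
  have hint : HasSum (fun n => ∫ j, recipProd p n * x ^ n * (1 - ((s : ℝ) ^ j) ^ n) ∂κ)
      (∫ j, (recipSeries p x - recipSeries p ((s : ℝ) ^ j * x)) ∂κ) := by
    have h1 := hasSum_integral_of_summable_integral_norm (μ := κ)
      (F := fun n (j : ℕ) => recipProd p n * x ^ n * (1 - ((s : ℝ) ^ j) ^ n))
      (fun n => (integrable_one_sub_pow hs1 n).const_mul _) ?_
    · convert! h1 using 3 with j
      refine (HasSum.tsum_eq ?_).symm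
      refine ((hI x).sub (hI ((s : ℝ) ^ j * x))).congr_fun fun n => ?_
      rw [mul_pow]; ring
    · refine Summable.of_nonneg_of_le (fun n => integral_nonneg fun j => norm_nonneg _)
        (fun n => ?_) ((hI x).summable.mul_right (κ.real univ))
      calc ∫ j, ‖recipProd p n * x ^ n * (1 - ((s : ℝ) ^ j) ^ n)‖ ∂κ
          ≤ ∫ j, recipProd p n * x ^ n ∂κ := by
            refine integral_mono ((integrable_one_sub_pow hs1 n).const_mul _).norm
              (integrable_const _) fun j => ?_
            simp only [norm_mul (recipProd p n * x ^ n), norm_of_nonneg (hcf n)]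
            exact mul_le_of_le_one_right (hcf n) (abs_one_sub_pow_le hs1 j n)
        _ = _ := by simp [mul_comm]
  have hL := (((hI ((s : ℝ)⁻¹ * x)).sub (hI x)).mul_left l).sub hint
  have hL' := (hasSum_nat_add_iff' 1).2 hL
  have hR := (hI x).mul_left x
  have hs : (s : ℝ) ≠ 0 := by exact_mod_cast hs0.ne'
  have hterm : ∀ n, l * (recipProd p (n + 1) * ((s : ℝ)⁻¹ * x) ^ (n + 1)
      - recipProd p (n + 1) * x ^ (n + 1))
      - ∫ j, recipProd p (n + 1) * x ^ (n + 1) * (1 - ((s : ℝ) ^ j) ^ (n + 1)) ∂κ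
      = x * (recipProd p n * x ^ n) := by
    intro n
    rw [integral_const_mul]
    have h1 : recipProd p n = recipProd p (n + 1) * p n := by
      rw [recipProd_succ, mul_assoc, inv_mul_cancel₀ (hp.pos n).ne', mul_one]
    have h2 : p n = l * ((s : ℝ)⁻¹ ^ (n + 1) - 1) - ∫ j, (1 - ((s : ℝ) ^ j) ^ (n + 1)) ∂κ := rfl
    rw [h1, h2, mul_pow]
    ring
  have hL'' := hL'.congr_fun (g := fun n => x * (recipProd p n * x ^ n)) fun n => (hterm n).symm
  have := hL''.unique hR
  simpa [recipProd_zero] using this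

/-- The one-step hitting time recursion of the lattice process. -/
noncomputable def latticeStep (l : ℝ) (s : NNReal) (κ : Measure ℕ) (A : NNReal → ℝ)
    (q : NNReal) : ℝ :=
  l / (l + κ.real univ + s * q - ∫ j, (∏ i ∈ Finset.range j, A (s ^ (i + 1) * q)) ∂κ)

lemma abs_prod_le_one {A : NNReal → ℝ} (hA0 : ∀ q, 0 ≤ A q) (hA1 : ∀ q, A q ≤ 1) (q : NNReal)
    (j : ℕ) : |∏ i ∈ Finset.range j, A (s ^ (i + 1) * q)| ≤ 1 := by
  rw [abs_of_nonneg (Finset.prod_nonneg fun _ _ => hA0 _)]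
  exact Finset.prod_le_one (fun _ _ => hA0 _) fun _ _ => hA1 _

lemma integrable_prod {A : NNReal → ℝ} (hA0 : ∀ q, 0 ≤ A q) (hA1 : ∀ q, A q ≤ 1) (q : NNReal) :
    Integrable (fun j => ∏ i ∈ Finset.range j, A (s ^ (i + 1) * q)) κ :=
  integrable_of_abs_le_one κ (measurable_of_countable _).aestronglyMeasurable
    fun j => abs_prod_le_one hA0 hA1 q j

lemma integral_prod_le {A : NNReal → ℝ} (hA0 : ∀ q, 0 ≤ A q) (hA1 : ∀ q, A q ≤ 1) (q : NNReal) :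
    ∫ j, (∏ i ∈ Finset.range j, A (s ^ (i + 1) * q)) ∂κ ≤ κ.real univ := by
  have := integral_mono (integrable_prod (κ := κ) (s := s) hA0 hA1 q)
    (integrable_const (1 : ℝ)) fun j => (le_abs_self _).trans (abs_prod_le_one hA0 hA1 q j)
  simpa using this

lemma hasSum_integral_nat {μ : Measure ℕ} {f : ℕ → ℝ} (hf : Integrable f μ) :
    HasSum (fun j => μ.real {j} * f j) (∫ j, f j ∂μ) := by
  have h := hasSum_integral_iUnion (μ := μ) (f := f) (s := fun n : ℕ => {n})
    (fun n => measurableSet_singleton n)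
    (fun i j hij => by simpa [Function.onFun] using hij) hf.integrableOn
  rw [iUnion_of_singleton, setIntegral_univ] at h
  simpa [Measure.real] using h

lemma latticeStep_mem (hl : 0 < l) {A : NNReal → ℝ} (hA : A ∈ cmSemiring)
    (hA1 : ∀ q, A q ≤ 1) : latticeStep l s κ A ∈ cmSemiring := by
  have hA0 := nonneg_of_mem_cmSemiring hA
  refine div_sub_mem_cmSemiring (c := κ.real univ) ?_ hl.le (by linarith) s.2
    (integral_prod_le hA0 hA1)
  refine mem_cmSemiring_of_hasSum (F := fun (j : ℕ) => (fun _ : NNReal => κ.real {j}) *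
    ∏ i ∈ Finset.range j, fun q => A (s ^ (i + 1) * q)) (fun j => ?_) fun q => ?_
  · exact mul_mem (const_mem_cmSemiring measureReal_nonneg)
      (prod_mem fun i _ => comp_mul_mem_cmSemiring hA _)
  · simpa using hasSum_integral_nat (μ := κ) (integrable_prod (s := s) hA0 hA1 q)

lemma latticeStep_denom_ge {A : NNReal → ℝ} (hA0 : ∀ q, 0 ≤ A q) (hA1 : ∀ q, A q ≤ 1)
    (q : NNReal) :
    l ≤ l + κ.real univ + s * q - ∫ j, (∏ i ∈ Finset.range j, A (s ^ (i + 1) * q)) ∂κ := by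
  have h1 := integral_prod_le (κ := κ) (s := s) hA0 hA1 q
  have h2 : (0 : ℝ) ≤ s * q := by positivity
  linarith

lemma latticeStep_le_one (hl : 0 < l) {A : NNReal → ℝ} (hA0 : ∀ q, 0 ≤ A q)
    (hA1 : ∀ q, A q ≤ 1) (q : NNReal) : latticeStep l s κ A q ≤ 1 := by
  have := latticeStep_denom_ge (l := l) (s := s) (κ := κ) hA0 hA1 q
  exact (div_le_one (hl.trans_le this)).2 this

lemma abs_prod_sub_prod_le {a b : ℕ → ℝ} (ha0 : ∀ i, 0 ≤ a i) (ha1 : ∀ i, a i ≤ 1)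
    (hb0 : ∀ i, 0 ≤ b i) (hb1 : ∀ i, b i ≤ 1) (j : ℕ) :
    |∏ i ∈ Finset.range j, a i - ∏ i ∈ Finset.range j, b i| ≤
      ∑ i ∈ Finset.range j, |a i - b i| := by
  induction j with
  | zero => simp
  | succ j ih =>
    rw [Finset.prod_range_succ, Finset.prod_range_succ, Finset.sum_range_succ]
    have h1 : (∏ i ∈ Finset.range j, a i) * a j - (∏ i ∈ Finset.range j, b i) * b j =
      (∏ i ∈ Finset.range j, a i - ∏ i ∈ Finset.range j, b i) * a j +
        (∏ i ∈ Finset.range j, b i) * (a j - b j) := by ring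
    rw [h1]
    refine (abs_add_le _ _).trans (add_le_add ?_ ?_)
    · rw [abs_mul, abs_of_nonneg (ha0 j)]
      exact (mul_le_of_le_one_right (abs_nonneg _) (ha1 j)).trans ih
    · rw [abs_mul, abs_of_nonneg (Finset.prod_nonneg fun i _ => hb0 i)]
      exact mul_le_of_le_one_left (abs_nonneg _)
        (Finset.prod_le_one (fun i _ => hb0 i) fun i _ => hb1 i)

/-- The contraction factor of `latticeStep`. -/
noncomputable def latticeRate (l : ℝ) (s : NNReal) (κ : Measure ℕ) : ℝ :=
  (s : ℝ) / (l * (1 - s)) * ∫ j, (1 - ((s : ℝ) ^ j) ^ (0 + 1)) ∂κ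

lemma latticeRate_nonneg {μ : Measure ℕ} (hl : 0 < l) (hs1 : s < 1) : 0 ≤ latticeRate l s μ := by
  have h1 : (0 : ℝ) < 1 - s := sub_pos.2 hs1
  refine mul_nonneg (by positivity) (integral_nonneg fun j => ?_)
  simpa using pow_le_one₀ s.2 hs1.le

lemma latticeRate_lt_one {μ : Measure ℕ} (hl : 0 < l) (hs0 : 0 < s) (hs1 : s < 1)
    (hpos : 0 < latticeExponent l s μ 0) : latticeRate l s μ < 1 := by
  have h1 : (0 : ℝ) < 1 - s := sub_pos.2 hs1
  have hs : (0 : ℝ) < s := hs0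
  rw [latticeExponent, sub_pos] at hpos
  calc latticeRate l s μ < (s : ℝ) / (l * (1 - s)) * (l * ((s : ℝ)⁻¹ ^ (0 + 1) - 1)) :=
        mul_lt_mul_of_pos_left hpos (by positivity)
    _ = 1 := by
        rw [zero_add, pow_one]
        field_simp

lemma abs_latticeStep_sub_le (hl : 0 < l) (hs1 : s < 1) {A B : NNReal → ℝ}
    (hA0 : ∀ q, 0 ≤ A q) (hA1 : ∀ q, A q ≤ 1) (hB0 : ∀ q, 0 ≤ B q) (hB1 : ∀ q, B q ≤ 1)
    {K : ℝ} (hK : ∀ q, |A q - B q| ≤ K * q) (q : NNReal) :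
    |latticeStep l s κ A q - latticeStep l s κ B q| ≤ latticeRate l s κ * K * q := by
  have h1s : (0 : ℝ) < 1 - s := sub_pos.2 hs1
  have hdA := latticeStep_denom_ge (l := l) (s := s) (κ := κ) hA0 hA1 q
  have hdB := latticeStep_denom_ge (l := l) (s := s) (κ := κ) hB0 hB1 q
  have hiA := integrable_prod (κ := κ) (s := s) hA0 hA1 q
  have hiB := integrable_prod (κ := κ) (s := s) hB0 hB1 q
  have hint : |(∫ j, (∏ i ∈ Finset.range j, A (s ^ (i + 1) * q)) ∂κ)
      - ∫ j, (∏ i ∈ Finset.range j, B (s ^ (i + 1) * q)) ∂κ| ≤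
      K * q * s / (1 - s) * ∫ j, (1 - ((s : ℝ) ^ j) ^ (0 + 1)) ∂κ := by
    rw [← integral_sub hiA hiB, ← integral_const_mul]
    refine (abs_integral_le_integral_abs).trans (integral_mono (hiA.sub hiB).abs
      ((integrable_one_sub_pow hs1 _).const_mul _) fun j => ?_)
    refine (abs_prod_sub_prod_le (fun _ => hA0 _) (fun _ => hA1 _) (fun _ => hB0 _)
      (fun _ => hB1 _) j).trans ?_
    refine (Finset.sum_le_sum fun i _ => hK _).trans (le_of_eq ?_)
    have hg := geom_sum_eq (x := (s : ℝ)) (by linarith) j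
    simp only [NNReal.coe_mul, NNReal.coe_pow, pow_succ]
    have h2 : ∀ i : ℕ, K * ((s : ℝ) ^ i * s * q) = K * q * s * (s : ℝ) ^ i := fun i => by ring
    simp only [h2, pow_zero, one_mul]
    rw [← Finset.mul_sum, hg]
    have : (s : ℝ) - 1 ≠ 0 := by linarith
    field_simp
    ring
  rw [latticeStep, latticeStep]
  set a := l + κ.real univ + s * q - ∫ j, (∏ i ∈ Finset.range j, A (s ^ (i + 1) * q)) ∂κ with ha
  set b := l + κ.real univ + s * q - ∫ j, (∏ i ∈ Finset.range j, B (s ^ (i + 1) * q)) ∂κ with hb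
  have ha0 : 0 < a := hl.trans_le hdA
  have hb0 : 0 < b := hl.trans_le hdB
  have hba : b - a = (∫ j, (∏ i ∈ Finset.range j, A (s ^ (i + 1) * q)) ∂κ)
      - ∫ j, (∏ i ∈ Finset.range j, B (s ^ (i + 1) * q)) ∂κ := by rw [ha, hb]; ring
  rw [← hba] at hint
  have h3 : l / a - l / b = l / (a * b) * (b - a) := by field_simp
  have h4 : l / (a * b) ≤ 1 / l := by
    rw [div_le_div_iff₀ (by positivity) hl]
    nlinarith [mul_le_mul hdA hdB hl.le ha0.le]
  rw [h3, abs_mul, abs_of_pos (by positivity)]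
  calc l / (a * b) * |b - a| ≤ 1 / l * |b - a| :=
        mul_le_mul_of_nonneg_right h4 (abs_nonneg _)
    _ ≤ 1 / l * (K * q * s / (1 - s) * ∫ j, (1 - ((s : ℝ) ^ j) ^ (0 + 1)) ∂κ) :=
        mul_le_mul_of_nonneg_left hint (by positivity)
    _ = _ := by
        rw [latticeRate]
        field_simp

lemma latticeStep_ratio (hl : 0 < l) (hs0 : 0 < s) (hs1 : s < 1)
    (hpos : 0 < latticeExponent l s κ 0) (q : NNReal) :
    latticeStep l s κ (fun q : NNReal => recipSeries (latticeExponent l s κ) (s * q) /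
        recipSeries (latticeExponent l s κ) q) q =
      recipSeries (latticeExponent l s κ) (s * q) / recipSeries (latticeExponent l s κ) q := by
  have hp := latticeExponent_linGrowth hl.le hs0 hs1 hpos
  set p := latticeExponent l s κ with hpdef
  have hIpos : ∀ q : NNReal, 0 < recipSeries p q := fun q =>
    zero_lt_one.trans_le (one_le_recipSeries hp q.2)
  have hs : (s : ℝ) ≠ 0 := by exact_mod_cast hs0.ne'
  have hx : (0 : ℝ) ≤ s * q := by positivity
  have hfe := lattice_functional_eq hp hs0 hs1 hx
  rw [inv_mul_cancel_left₀ hs] at hfe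
  have hIs : 0 < recipSeries p (s * q) := by simpa using hIpos (s * q)
  have htel : ∀ j : ℕ, ∏ i ∈ Finset.range j, (recipSeries p (s * ((s ^ (i + 1) * q : NNReal) : ℝ)) /
      recipSeries p ((s ^ (i + 1) * q : NNReal) : ℝ)) =
      1 - (recipSeries p (s * q) - recipSeries p ((s : ℝ) ^ j * (s * q))) * (recipSeries p (s * q))⁻¹ := by
    intro j
    have h1 := prod_range_div_of_ne_zero
      (f := fun i => recipSeries p ((s ^ (i + 1) * q : NNReal) : ℝ)) (fun i => (hIpos _).ne') j
    have h2 : ∀ i : ℕ, (s : ℝ) * ((s ^ (i + 1) * q : NNReal) : ℝ) =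
        ((s ^ (i + 1 + 1) * q : NNReal) : ℝ) := fun i => by push_cast; ring
    simp only [h2]
    rw [h1]
    have h3 : (s : ℝ) ^ j * (s * q) = ((s ^ (j + 1) * q : NNReal) : ℝ) := by push_cast; ring
    rw [h3]
    simp only [zero_add, pow_one, NNReal.coe_mul]
    rw [sub_mul, mul_inv_cancel₀ hIs.ne', sub_sub_cancel, div_eq_mul_inv]
  have hintg : Integrable (fun j : ℕ => recipSeries p (s * q)
      - recipSeries p ((s : ℝ) ^ j * (s * q))) κ := by
    refine (integrable_const (recipSeries p (s * q))).mono'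
      (measurable_of_countable _).aestronglyMeasurable (Eventually.of_forall fun j => ?_)
    have h0 : (0 : ℝ) ≤ (s : ℝ) ^ j * (s * q) := by positivity
    have h1 : (s : ℝ) ^ j * (s * q) ≤ s * q :=
      mul_le_of_le_one_left hx (pow_le_one₀ s.2 hs1.le)
    have h2 := recipSeries_mono hp h0 h1
    have h3 := one_le_recipSeries hp h0
    rw [norm_eq_abs, abs_of_nonneg (sub_nonneg.2 h2)]
    linarith
  rw [latticeStep]
  simp only [htel]
  rw [integral_sub (integrable_const _) (hintg.mul_const _), integral_mul_const]
  simp only [integral_const, smul_eq_mul, mul_one]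
  set J := ∫ j, (recipSeries p (s * q) - recipSeries p ((s : ℝ) ^ j * (s * q))) ∂κ
  have hIq := hIpos q
  have hden : l + κ.real univ + s * q - (κ.real univ - J * (recipSeries p (s * q))⁻¹) =
      l * recipSeries p q / recipSeries p (s * q) := by
    field_simp
    linarith
  rw [hden]
  field_simp

lemma ratio_mem_cmSemiring (hl : 0 < l) (hs0 : 0 < s) (hs1 : s < 1)
    (hpos : 0 < latticeExponent l s κ 0) :
    (fun q : NNReal => recipSeries (latticeExponent l s κ) (s * q) /
      recipSeries (latticeExponent l s κ) q) ∈ cmSemiring := by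
  have hp := latticeExponent_linGrowth hl.le hs0 hs1 hpos
  set p := latticeExponent l s κ with hpdef
  set R : NNReal → ℝ := fun q => recipSeries p (s * q) / recipSeries p q with hR
  have hI1 : ∀ q : NNReal, 1 ≤ recipSeries p q := fun q => one_le_recipSeries hp q.2
  have hIs1 : ∀ q : NNReal, 1 ≤ recipSeries p (s * q) := fun q =>
    one_le_recipSeries hp (by positivity)
  have hR0 : ∀ q, 0 ≤ R q := fun q =>
    div_nonneg (zero_le_one.trans (hIs1 q)) (zero_le_one.trans (hI1 q))
  have hR1 : ∀ q, R q ≤ 1 := fun q => (div_le_one (zero_lt_one.trans_le (hI1 q))).2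
    (recipSeries_mono hp (by positivity) (mul_le_of_le_one_left q.2 hs1.le))
  have hfix : latticeStep l s κ R = R := funext fun q => latticeStep_ratio hl hs0 hs1 hpos q
  let A : ℕ → NNReal → ℝ := fun n => (latticeStep l s κ)^[n] 1
  have hA : ∀ n, A n ∈ cmSemiring ∧ (∀ q, A n q ≤ 1) ∧
      ∀ q : NNReal, |A n q - R q| ≤ latticeRate l s κ ^ n * (p 0)⁻¹ * q := by
    intro n
    induction n with
    | zero =>
      refine ⟨one_mem _, fun q => le_rfl, fun q => ?_⟩
      have h1 := recipSeries_sub_one_le hp q.2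
      have hIq := zero_lt_one.trans_le (hI1 q)
      change |1 - R q| ≤ _
      rw [abs_of_nonneg (sub_nonneg.2 (hR1 q)), pow_zero, one_mul, hR]
      simp only
      rw [one_sub_div hIq.ne', div_le_iff₀ hIq]
      exact (sub_le_sub_left (hIs1 q) _).trans h1
    | succ n ih =>
      obtain ⟨hm, h1, hd⟩ := ih
      have h0 := nonneg_of_mem_cmSemiring hm
      have hsucc : A (n + 1) = latticeStep l s κ (A n) := Function.iterate_succ_apply' _ _ _
      rw [hsucc]
      refine ⟨latticeStep_mem hl hm h1, latticeStep_le_one hl h0 h1, fun q => ?_⟩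
      have := abs_latticeStep_sub_le (κ := κ) hl hs1 h0 h1 hR0 hR1 hd q
      rw [hfix] at this
      rw [pow_succ', mul_assoc (latticeRate l s κ)]
      exact this
  have hlim : Tendsto A atTop (𝓝 R) := by
    refine tendsto_pi_nhds.2 fun q => ?_
    rw [tendsto_iff_norm_sub_tendsto_zero]
    have h0 : Tendsto (fun n => latticeRate l s κ ^ n * (p 0)⁻¹ * q) atTop (𝓝 0) := by
      have := ((tendsto_pow_atTop_nhds_zero_of_lt_one (latticeRate_nonneg (μ := κ) hl hs1)
        (latticeRate_lt_one hl hs0 hs1 hpos)).mul_const (p 0)⁻¹).mul_const (q : ℝ)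
      simpa using this
    exact squeeze_zero (fun n => norm_nonneg _) (fun n => (hA n).2.2 q) h0
  exact isClosed_cmSemiring.mem_of_tendsto hlim (Eventually.of_forall fun n => (hA n).1)

end Lattice

/-- The scale-invariant logarithmic derivative of `recipSeries p`, that is `q` times the derivative of its
logarithm at `q`. -/
noncomputable def eulerLogDeriv (p : ℕ → ℝ) (q : NNReal) : ℝ :=
  (∑' n : ℕ, (n : ℝ) * (recipProd p n * (q : ℝ) ^ n)) / recipSeries p q

lemma abs_natCast_le_two_pow (n : ℕ) : |(n : ℝ)| ≤ 2 ^ n := by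
  rw [Nat.abs_cast]
  exact_mod_cast Nat.lt_two_pow_self.le

lemma tendsto_weighted_ratio {ι : Type*} {l : Filter ι} {P : ι → ℕ → ℝ} {p : ℕ → ℝ}
    (hP : ∀ᶠ i in l, LinGrowth (P i)) (hp : LinGrowth p)
    (hlim : ∀ k, Tendsto (fun i => P i k) l (𝓝 (p k)))
    {W : ι → ℕ → ℝ} (hW : ∀ᶠ i in l, ∀ n, |W i n| ≤ 2 ^ n)
    (hWlim : ∀ n : ℕ, Tendsto (fun i => W i n) l (𝓝 n)) :
    Tendsto (fun i (q : NNReal) => (∑' n, W i n * (recipProd (P i) n * (q : ℝ) ^ n)) /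
      recipSeries (P i) q) l (𝓝 (eulerLogDeriv p)) := by
  refine tendsto_pi_nhds.2 fun q => ?_
  refine (tendsto_weighted_recipSeries hP hp.pos_zero hlim (fun k => (hp.pos k).ne') hW hWlim q).div
    ?_ (zero_lt_one.trans_le (one_le_recipSeries hp q.2)).ne'
  simpa [recipSeries] using tendsto_weighted_recipSeries hP hp.pos_zero hlim
    (fun k => (hp.pos k).ne') (W := fun _ _ => 1) (w := fun _ => 1)
    (Eventually.of_forall fun i n => by simpa using one_le_pow₀ (one_le_two (α := ℝ)))
    (fun n => tendsto_const_nhds) q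

lemma tendsto_eulerLogDeriv {ι : Type*} {l : Filter ι} {P : ι → ℕ → ℝ} {p : ℕ → ℝ}
    (hP : ∀ᶠ i in l, LinGrowth (P i)) (hp : LinGrowth p)
    (hlim : ∀ k, Tendsto (fun i => P i k) l (𝓝 (p k))) :
    Tendsto (fun i => eulerLogDeriv (P i)) l (𝓝 (eulerLogDeriv p)) :=
  tendsto_weighted_ratio (W := fun _ n => (n : ℝ)) hP hp hlim
    (Eventually.of_forall fun _ n => abs_natCast_le_two_pow n) fun _ => tendsto_const_nhds

/-- The values `ψ (α * (k + 1))` of the Laplace exponent `ψ` of a compound Poisson process with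
drift `d` and downward jumps governed by `ν`. -/
noncomputable def driftExponent (d : ℝ) (ν : Measure ℝ) (α : ℝ) (k : ℕ) : ℝ :=
  d * (α * (k + 1)) - ∫ r, (1 - exp (-(α * (k + 1)) * r)) ∂ν

lemma tendsto_mul_floor_div (r : ℝ) (hr : 0 < r) :
    Tendsto (fun h : ℝ => h * (⌊r / h⌋₊ : ℝ)) (𝓝[>] 0) (𝓝 r) := by
  have h1 : Tendsto (fun h : ℝ => r - h) (𝓝[>] 0) (𝓝 r) := by
    have : Tendsto (fun h : ℝ => r - h) (𝓝 0) (𝓝 (r - 0)) := tendsto_const_nhds.sub tendsto_id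
    rw [sub_zero] at this
    exact this.mono_left nhdsWithin_le_nhds
  refine tendsto_of_tendsto_of_tendsto_of_le_of_le' h1 tendsto_const_nhds ?_ ?_
  · filter_upwards [self_mem_nhdsWithin] with h (hh : 0 < h)
    have := Nat.lt_floor_add_one (r / h)
    rw [div_lt_iff₀ hh] at this
    nlinarith
  · filter_upwards [self_mem_nhdsWithin] with h (hh : 0 < h)
    have := Nat.floor_le (a := r / h) (by positivity)
    rw [le_div_iff₀ hh] at this
    linarith

/-- The lattice scaling factor `exp (-α * h)`. -/
noncomputable def latticeScale (α h : ℝ) : NNReal := ⟨exp (-(α * h)), (exp_pos _).le⟩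

lemma coe_latticeScale (α h : ℝ) : (latticeScale α h : ℝ) = exp (-(α * h)) := rfl

lemma measurable_floor_div (h : ℝ) : Measurable fun r : ℝ => ⌊r / h⌋₊ :=
  Nat.measurable_floor.comp (measurable_id.div_const h)

lemma tendsto_latticeExponent {d α : ℝ} {ν : Measure ℝ} [IsFiniteMeasure ν] (hα : 0 < α)
    (hν : ∀ᵐ r ∂ν, 0 < r) (k : ℕ) :
    Tendsto (fun h : ℝ => latticeExponent (d / h) (latticeScale α h)
      (ν.map fun r => ⌊r / h⌋₊) k) (𝓝[>] 0) (𝓝 (driftExponent d ν α k)) := by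
  have hrepr : ∀ h : ℝ, latticeExponent (d / h) (latticeScale α h) (ν.map fun r => ⌊r / h⌋₊) k =
      d * (h⁻¹ * (exp (h * (α * (k + 1))) - 1)) -
        ∫ r, (1 - exp (-(α * (k + 1)) * (h * (⌊r / h⌋₊ : ℝ)))) ∂ν := by
    intro h
    rw [latticeExponent, integral_map (measurable_floor_div h).aemeasurable
      (measurable_of_countable _).aestronglyMeasurable, coe_latticeScale]
    have e1 : (exp (-(α * h)))⁻¹ ^ (k + 1) = exp (h * (α * (k + 1))) := by
      rw [← exp_neg, ← exp_nat_mul]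
      push_cast
      ring_nf
    have e2 : ∀ j : ℕ, (exp (-(α * h)) ^ j) ^ (k + 1) = exp (-(α * (k + 1)) * (h * j)) := by
      intro j
      rw [← exp_nat_mul, ← exp_nat_mul]
      push_cast
      ring_nf
    simp only [e1, e2]
    ring
  simp only [hrepr]
  refine Tendsto.sub (Tendsto.const_mul _ ?_) ?_
  · have h1 : HasDerivAt (fun h : ℝ => exp (h * (α * (k + 1)))) (α * (k + 1)) 0 := by
      simpa using ((hasDerivAt_id (0 : ℝ)).mul_const (α * (k + 1))).exp
    refine ((hasDerivAt_iff_tendsto_slope.1 h1).mono_left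
      (nhdsWithin_mono _ fun x hx => ne_of_gt hx)).congr fun h => ?_
    simp [slope_def_field, div_eq_inv_mul]
  · refine tendsto_integral_filter_of_dominated_convergence (fun _ => 1) ?_ ?_
      (integrable_const _) ?_
    · refine Eventually.of_forall fun h => Measurable.aestronglyMeasurable ?_
      exact (measurable_of_countable
        (fun j : ℕ => 1 - exp (-(α * (k + 1)) * (h * (j : ℝ))))).comp (measurable_floor_div h)
    · filter_upwards [self_mem_nhdsWithin] with h (hh : 0 < h)
      refine Eventually.of_forall fun r => ?_
      have h1 : exp (-(α * (k + 1)) * (h * (⌊r / h⌋₊ : ℝ))) ≤ 1 := by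
        rw [exp_le_one_iff, neg_mul, neg_nonpos]
        positivity
      rw [norm_eq_abs, abs_of_nonneg (sub_nonneg.2 h1)]
      linarith [exp_pos (-(α * (k + 1)) * (h * (⌊r / h⌋₊ : ℝ)))]
    · filter_upwards [hν] with r hr
      exact tendsto_const_nhds.sub (((tendsto_mul_floor_div r hr).const_mul _).rexp)

lemma driftExponent_drift_pos {d α : ℝ} {ν : Measure ℝ} (hα : 0 < α) (hν : ∀ᵐ r ∂ν, 0 < r)
    (hpos : 0 < driftExponent d ν α 0) : 0 < d := by
  have h1 : 0 ≤ ∫ r, (1 - exp (-(α * ((0 : ℕ) + 1)) * r)) ∂ν := by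
    refine integral_nonneg_of_ae ?_
    filter_upwards [hν] with r hr
    have : exp (-(α * ((0 : ℕ) + 1)) * r) ≤ 1 := by
      rw [exp_le_one_iff, neg_mul, neg_nonpos]
      positivity
    exact sub_nonneg.2 this
  rw [driftExponent] at hpos
  have h2 : 0 < d * (α * ((0 : ℕ) + 1)) := by linarith
  have h3 : 0 < α * (((0 : ℕ) : ℝ) + 1) := by positivity
  exact pos_of_mul_pos_left h2 h3.le

lemma eventually_latticeExponent_linGrowth {d α : ℝ} {ν : Measure ℝ} [IsFiniteMeasure ν]
    (hα : 0 < α) (hν : ∀ᵐ r ∂ν, 0 < r) (hpos : 0 < driftExponent d ν α 0) :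
    ∀ᶠ h in 𝓝[>] (0 : ℝ), 0 < d / h ∧ 0 < latticeScale α h ∧ latticeScale α h < 1 ∧
      0 < latticeExponent (d / h) (latticeScale α h) (ν.map fun r => ⌊r / h⌋₊) 0 := by
  filter_upwards [self_mem_nhdsWithin,
    (tendsto_latticeExponent (d := d) hα hν 0).eventually_const_lt hpos] with h (hh : 0 < h) hh2
  refine ⟨div_pos (driftExponent_drift_pos hα hν hpos) hh, exp_pos _, ?_, hh2⟩
  rw [← NNReal.coe_lt_coe, coe_latticeScale, NNReal.coe_one, exp_lt_one_iff]
  linarith [mul_pos hα hh]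

lemma driftExponent_linGrowth {d α : ℝ} {ν : Measure ℝ} [IsFiniteMeasure ν] (hα : 0 < α)
    (hν : ∀ᵐ r ∂ν, 0 < r) (hpos : 0 < driftExponent d ν α 0) :
    LinGrowth (driftExponent d ν α) := by
  refine LinGrowth.of_tendsto ?_ hpos fun k => tendsto_latticeExponent hα hν k
  filter_upwards [eventually_latticeExponent_linGrowth hα hν hpos] with h ⟨h1, h2, h3, h4⟩
  exact latticeExponent_le h1.le h2 h3

lemma eulerLogDeriv_driftExponent_mem {d α : ℝ} {ν : Measure ℝ} [IsFiniteMeasure ν] (hα : 0 < α)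
    (hν : ∀ᵐ r ∂ν, 0 < r) (hpos : 0 < driftExponent d ν α 0) :
    eulerLogDeriv (driftExponent d ν α) ∈ bernsteinCone := by
  have hev := eventually_latticeExponent_linGrowth hα hν hpos
  have hscale : Tendsto (fun h => (latticeScale α h : ℝ)) (𝓝[>] 0) (𝓝 1) := by
    have : Tendsto (fun h => exp (-(α * h))) (𝓝 0) (𝓝 (exp (-(α * 0)))) := by
      apply Continuous.tendsto
      fun_prop
    rw [mul_zero, neg_zero, exp_zero] at this
    exact this.mono_left nhdsWithin_le_nhds
  refine isClosed_bernsteinCone.mem_of_tendsto (tendsto_weighted_ratio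
    (W := fun h n => ∑ i ∈ Finset.range n, (latticeScale α h : ℝ) ^ i)
    (hev.mono fun h ⟨h1, h2, h3, h4⟩ => latticeExponent_linGrowth h1.le h2 h3 h4)
    (driftExponent_linGrowth hα hν hpos) (fun k => tendsto_latticeExponent hα hν k) ?_ ?_) ?_
  · filter_upwards [hev] with h ⟨_, _, h3, _⟩ n
    rw [abs_of_nonneg (Finset.sum_nonneg fun i _ => by positivity)]
    calc ∑ i ∈ Finset.range n, (latticeScale α h : ℝ) ^ i ≤ ∑ i ∈ Finset.range n, (1 : ℝ) :=
          Finset.sum_le_sum fun i _ => pow_le_one₀ (latticeScale α h).2 h3.le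
      _ ≤ 2 ^ n := by simpa using abs_natCast_le_two_pow n
  · intro n
    have := tendsto_finsetSum (Finset.range n) fun i _ => hscale.pow i
    simpa using this
  · filter_upwards [hev] with h ⟨h1, h2, h3, h4⟩
    have hp := latticeExponent_linGrowth h1.le h2 h3 h4
    have hmem := sub_mem_bernsteinCone_of_mem_cmSemiring (ratio_mem_cmSemiring h1 h2 h3 h4)
    have hs : (0 : ℝ) < 1 - latticeScale α h := sub_pos.2 h3
    convert! bernsteinCone_smul_mem hmem (Real.toNNReal (1 - latticeScale α h)⁻¹) using 1
    ext q
    rw [Real.coe_toNNReal _ (by positivity)]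
    set p := latticeExponent (d / h) (latticeScale α h) (ν.map fun r => ⌊r / h⌋₊)
    set s := latticeScale α h
    have hI := zero_lt_one.trans_le (one_le_recipSeries hp q.2)
    have hsum : HasSum (fun n => (∑ i ∈ Finset.range n, (s : ℝ) ^ i) *
        (recipProd p n * (q : ℝ) ^ n))
        ((1 - (s : ℝ))⁻¹ * (recipSeries p q - recipSeries p (s * q))) := by
      refine (((hasSum_recipSeries hp q).sub (hasSum_recipSeries hp (s * q))).mul_left
        (1 - (s : ℝ))⁻¹).congr_fun fun n => ?_
      rw [geom_sum_eq (by linarith), mul_pow]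
      have : (s : ℝ) - 1 ≠ 0 := by linarith
      field_simp
      ring
    rw [hsum.tsum_eq]
    simp only [NNReal.coe_zero, mul_zero, recipSeries_zero, div_one]
    have hI' : recipSeries p q ≠ 0 := hI.ne'
    field_simp

lemma exp_neg_sub_one_add_nonneg (x : ℝ) : 0 ≤ exp (-x) - 1 + x := by
  linarith [add_one_le_exp (-x)]

lemma exp_neg_sub_one_add_le_sq {x : ℝ} (hx : 0 ≤ x) : exp (-x) - 1 + x ≤ x ^ 2 := by
  rcases le_total x 1 with h | h
  · have := abs_exp_sub_one_sub_id_le (x := -x) (by rwa [abs_neg, abs_of_nonneg hx])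
    rw [neg_sq] at this
    linarith [le_abs_self (exp (-x) - 1 - -x)]
  · have : exp (-x) ≤ 1 := exp_le_one_iff.2 (by linarith)
    nlinarith

lemma tendsto_exp_neg_taylor_two (u : ℝ) :
    Tendsto (fun ε : ℝ => (exp (-(u * ε)) - 1 + u * ε) / ε ^ 2) (𝓝[>] 0) (𝓝 (u ^ 2 / 2)) := by
  rw [tendsto_iff_norm_sub_tendsto_zero]
  have hlim : Tendsto (fun ε : ℝ => |u| ^ 3 * |ε|) (𝓝[>] 0) (𝓝 0) := by
    have : Tendsto (fun ε : ℝ => |u| ^ 3 * |ε|) (𝓝 0) (𝓝 (|u| ^ 3 * |0|)) := by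
      apply Continuous.tendsto
      fun_prop
    rw [abs_zero, mul_zero] at this
    exact this.mono_left nhdsWithin_le_nhds
  have hsmall : ∀ᶠ ε in 𝓝[>] (0 : ℝ), |u * ε| < 1 := by
    have : Tendsto (fun ε : ℝ => |u * ε|) (𝓝 0) (𝓝 |u * 0|) := by
      apply Continuous.tendsto
      fun_prop
    rw [mul_zero, abs_zero] at this
    exact (this.mono_left nhdsWithin_le_nhds).eventually_lt_const one_pos
  refine squeeze_zero' (Eventually.of_forall fun _ => norm_nonneg _) ?_ hlim
  filter_upwards [hsmall, self_mem_nhdsWithin] with ε h1 (hε : 0 < ε)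
  have h2 := Real.exp_bound (x := -(u * ε)) (by rw [abs_neg]; exact h1.le) (n := 3) (by norm_num)
  simp only [Finset.sum_range_succ, Finset.sum_range_zero, Nat.factorial, abs_neg] at h2
  have h3 : (exp (-(u * ε)) - 1 + u * ε) / ε ^ 2 - u ^ 2 / 2 =
      (exp (-(u * ε)) - (1 - u * ε + (u * ε) ^ 2 / 2)) / ε ^ 2 := by
    field_simp
    ring
  rw [h3, norm_eq_abs, abs_div, abs_of_pos (a := ε ^ 2) (by positivity), div_le_iff₀ (by positivity)]
  have h4 : |u * ε| ^ 3 = |u| ^ 3 * |ε| * ε ^ 2 := by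
    rw [abs_mul, mul_pow, pow_succ |ε|, sq_abs]; ring
  rw [← h4]
  have h5 : 0 ≤ |u * ε| ^ 3 := by positivity
  norm_num at h2
  refine (le_of_eq ?_).trans (h2.trans ?_)
  · congr 1
  · rw [abs_mul] at h5 ⊢
    linarith

section LevyMeasure

variable {ν : Measure ℝ}

lemma integrableOn_min_one_sq
    (hν : ∫⁻ r in Ioi (0 : ℝ), ENNReal.ofReal (min 1 (r ^ 2)) ∂ν < ⊤) :
    IntegrableOn (fun r : ℝ => min 1 (r ^ 2)) (Ioi 0) ν := by
  refine ⟨(by fun_prop : Measurable fun r : ℝ => min 1 (r ^ 2)).aestronglyMeasurable, ?_⟩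
  rw [hasFiniteIntegral_iff_ofReal (Eventually.of_forall fun r => le_min zero_le_one (sq_nonneg r))]
  exact hν

/-- The integrand of the Laplace exponent. -/
noncomputable def psiIntegrand (u r : ℝ) : ℝ :=
  exp (-u * r) - 1 + (if r ≤ 1 then u * r else 0)

lemma measurable_psiIntegrand (u : ℝ) : Measurable (psiIntegrand u) := by
  unfold psiIntegrand
  refine Measurable.add (by fun_prop) (Measurable.ite measurableSet_Iic (by fun_prop) (by fun_prop))

lemma abs_psiIntegrand_le {u r : ℝ} (hu : 0 ≤ u) (hr : 0 < r) :
    |psiIntegrand u r| ≤ (1 + u ^ 2) * min 1 (r ^ 2) := by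
  rw [psiIntegrand, neg_mul]
  have hur : 0 ≤ u * r := by positivity
  split_ifs with h
  · rw [abs_of_nonneg (exp_neg_sub_one_add_nonneg _), min_eq_right (by nlinarith)]
    have := exp_neg_sub_one_add_le_sq hur
    nlinarith [sq_nonneg r]
  · rw [add_zero, min_eq_left (by nlinarith), mul_one, abs_sub_comm, abs_of_nonneg]
    · nlinarith [exp_pos (-(u * r)), sq_nonneg u]
    · rw [sub_nonneg, exp_le_one_iff]; linarith

lemma integrableOn_psiIntegrand
    (hν : ∫⁻ r in Ioi (0 : ℝ), ENNReal.ofReal (min 1 (r ^ 2)) ∂ν < ⊤) {u : ℝ} (hu : 0 ≤ u) :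
    IntegrableOn (psiIntegrand u) (Ioi 0) ν :=
  Integrable.mono' ((integrableOn_min_one_sq hν).const_mul (1 + u ^ 2))
    (measurable_psiIntegrand u).aestronglyMeasurable
    (ae_restrict_of_forall_mem measurableSet_Ioi fun _ hr => abs_psiIntegrand_le hu hr)

lemma measure_Ioi_lt_top
    (hν : ∫⁻ r in Ioi (0 : ℝ), ENNReal.ofReal (min 1 (r ^ 2)) ∂ν < ⊤) {ε : ℝ} (hε : 0 < ε) :
    ν (Ioi ε) < ⊤ := by
  have h1 := (integrableOn_min_one_sq hν).measure_ge_lt_top (ε := min 1 (ε ^ 2))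
    (lt_min one_pos (by positivity))
  refine lt_of_le_of_lt ?_ h1
  have h2 : ν (Ioi ε) = ν.restrict (Ioi 0) (Ioi ε) := by
    rw [Measure.restrict_apply measurableSet_Ioi, inter_eq_left.2 (Ioi_subset_Ioi hε.le)]
  rw [h2]
  refine measure_mono fun r (hr : ε < r) => ?_
  change min 1 (ε ^ 2) ≤ min 1 (r ^ 2)
  gcongr

/-- The jump measure obtained by removing the jumps of size at most `ε` and replacing the Gaussian
component by jumps of size `ε`. -/
noncomputable def truncMeasure (σ : ℝ) (ν : Measure ℝ) (ε : ℝ) : Measure ℝ :=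
  ν.restrict (Ioi ε) + (Real.toNNReal (σ / ε ^ 2)) • Measure.dirac ε

/-- The drift compensating `truncMeasure`. -/
noncomputable def truncDrift (σ b : ℝ) (ν : Measure ℝ) (ε : ℝ) : ℝ :=
  b + ∫ r in Ioc ε 1, r ∂ν + σ / ε

lemma isFiniteMeasure_truncMeasure (σ : ℝ)
    (hν : ∫⁻ r in Ioi (0 : ℝ), ENNReal.ofReal (min 1 (r ^ 2)) ∂ν < ⊤) {ε : ℝ} (hε : 0 < ε) :
    IsFiniteMeasure (truncMeasure σ ν ε) := by
  have : IsFiniteMeasure (ν.restrict (Ioi ε)) :=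
    ⟨by rw [Measure.restrict_apply_univ]; exact measure_Ioi_lt_top hν hε⟩
  unfold truncMeasure
  infer_instance

lemma truncMeasure_ae_pos (σ : ℝ) (ν : Measure ℝ) {ε : ℝ} (hε : 0 < ε) :
    ∀ᵐ r ∂(truncMeasure σ ν ε), 0 < r := by
  rw [truncMeasure, ae_add_measure_iff]
  refine ⟨ae_restrict_of_forall_mem measurableSet_Ioi fun r hr => hε.trans hr, ?_⟩
  exact Measure.ae_smul_measure ((ae_dirac_iff measurableSet_Ioi).2 hε) _

lemma driftExponent_trunc {σ b : ℝ} (hσ : 0 ≤ σ)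
    (hν : ∫⁻ r in Ioi (0 : ℝ), ENNReal.ofReal (min 1 (r ^ 2)) ∂ν < ⊤) {α : ℝ} (hα : 0 < α)
    {ε : ℝ} (hε : 0 < ε) (k : ℕ) :
    driftExponent (truncDrift σ b ν ε) (truncMeasure σ ν ε) α k =
      b * (α * (k + 1)) + σ * ((exp (-(α * (k + 1) * ε)) - 1 + α * (k + 1) * ε) / ε ^ 2) +
        ∫ r in Ioi (0 : ℝ), (Ioi ε).indicator (psiIntegrand (α * (k + 1))) r ∂ν := by
  have : IsFiniteMeasure (ν.restrict (Ioi ε)) :=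
    ⟨by rw [Measure.restrict_apply_univ]; exact measure_Ioi_lt_top hν hε⟩
  set u := α * (k + 1) with hu
  have hu0 : 0 < u := by positivity
  have hsub : Ioc ε 1 ⊆ Ioi ε := fun r hr => hr.1
  have hint : IntegrableOn (psiIntegrand u) (Ioi ε) ν :=
    (integrableOn_psiIntegrand hν hu0.le).mono_set (Ioi_subset_Ioi hε.le)
  have hexp : Integrable (fun r => 1 - exp (-u * r)) (ν.restrict (Ioi ε)) := by
    refine (integrable_const (1 : ℝ)).mono' (by fun_prop) ?_
    refine ae_restrict_of_forall_mem measurableSet_Ioi fun r (hr : ε < r) => ?_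
    have hr0 : 0 < r := hε.trans hr
    have h1 : exp (-u * r) ≤ 1 := by
      rw [exp_le_one_iff, neg_mul, neg_nonpos]
      positivity
    rw [norm_eq_abs, abs_of_nonneg (sub_nonneg.2 h1)]
    linarith [exp_pos (-u * r)]
  have hsplit : ∫ r in Ioi ε, psiIntegrand u r ∂ν =
      u * ∫ r in Ioc ε 1, r ∂ν - ∫ r in Ioi ε, (1 - exp (-u * r)) ∂ν := by
    have h1 : ∀ r ∈ Ioi ε, psiIntegrand u r + (1 - exp (-u * r)) =
        (Ioc ε 1).indicator (fun r => u * r) r := by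
      intro r hr
      by_cases h : r ≤ 1
      · rw [indicator_of_mem (show r ∈ Ioc ε 1 from ⟨hr, h⟩)]
        simp only [psiIntegrand, h, if_true]
        ring
      · rw [indicator_of_notMem (fun h' => h h'.2)]
        simp [psiIntegrand, h]
    have h2 := setIntegral_congr_fun (μ := ν) measurableSet_Ioi h1
    rw [integral_add hint hexp, setIntegral_indicator measurableSet_Ioc,
      inter_eq_right.2 hsub, integral_const_mul] at h2
    linarith
  have hdirac : Integrable (fun r => 1 - exp (-u * r))
      ((Real.toNNReal (σ / ε ^ 2)) • Measure.dirac ε) :=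
    (integrable_dirac (by simp)).smul_measure (by simp)
  rw [driftExponent, ← hu, truncMeasure, integral_add_measure hexp hdirac,
    integral_smul_nnreal_measure, integral_dirac, setIntegral_indicator measurableSet_Ioi,
    inter_eq_right.2 (Ioi_subset_Ioi hε.le), hsplit, NNReal.smul_def,
    Real.coe_toNNReal _ (by positivity), truncDrift, smul_eq_mul, neg_mul]
  field_simp
  ring

lemma tendsto_driftExponent_trunc {σ b : ℝ} (hσ : 0 ≤ σ)
    (hν : ∫⁻ r in Ioi (0 : ℝ), ENNReal.ofReal (min 1 (r ^ 2)) ∂ν < ⊤) {α : ℝ} (hα : 0 < α)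
    (k : ℕ) :
    Tendsto (fun ε => driftExponent (truncDrift σ b ν ε) (truncMeasure σ ν ε) α k) (𝓝[>] 0)
      (𝓝 (psi σ b ν (α * (k + 1)))) := by
  have hu0 : 0 ≤ α * (k + 1) := by positivity
  have h1 : Tendsto (fun ε => b * (α * (k + 1)) +
      σ * ((exp (-(α * (k + 1) * ε)) - 1 + α * (k + 1) * ε) / ε ^ 2) +
        ∫ r in Ioi (0 : ℝ), (Ioi ε).indicator (psiIntegrand (α * (k + 1))) r ∂ν) (𝓝[>] 0)
      (𝓝 (b * (α * (k + 1)) + σ * ((α * (k + 1)) ^ 2 / 2) +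
        ∫ r in Ioi (0 : ℝ), psiIntegrand (α * (k + 1)) r ∂ν)) := by
    refine (tendsto_const_nhds.add ((tendsto_exp_neg_taylor_two _).const_mul σ)).add ?_
    refine tendsto_integral_filter_of_dominated_convergence _
      (Eventually.of_forall fun ε => ((measurable_psiIntegrand _).indicator
        measurableSet_Ioi).aestronglyMeasurable)
      (Eventually.of_forall fun ε => Eventually.of_forall fun r => norm_indicator_le_norm_self _ _)
      (integrableOn_psiIntegrand hν hu0).norm ?_
    refine ae_restrict_of_forall_mem measurableSet_Ioi fun r (hr : 0 < r) => ?_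
    refine tendsto_const_nhds.congr' ?_
    filter_upwards [Ioo_mem_nhdsGT hr] with ε hε
    rw [indicator_of_mem (show r ∈ Ioi ε from hε.2)]
  have h2 : psi σ b ν (α * (k + 1)) = b * (α * (k + 1)) + σ * ((α * (k + 1)) ^ 2 / 2) +
        ∫ r in Ioi (0 : ℝ), psiIntegrand (α * (k + 1)) r ∂ν := by
    rw [psi]
    simp only [psiIntegrand]
    ring
  rw [h2]
  refine h1.congr' ?_
  filter_upwards [self_mem_nhdsWithin] with ε (hε : 0 < ε)
  exact (driftExponent_trunc hσ hν hα hε k).symm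

lemma psi_linGrowth_and_mem {σ b : ℝ} (hσ : 0 ≤ σ)
    (hν : ∫⁻ r in Ioi (0 : ℝ), ENNReal.ofReal (min 1 (r ^ 2)) ∂ν < ⊤) {α : ℝ} (hα : 0 < α)
    (hpos : 0 < psi σ b ν α) :
    LinGrowth (fun k : ℕ => psi σ b ν (α * (k + 1))) ∧
      eulerLogDeriv (fun k : ℕ => psi σ b ν (α * (k + 1))) ∈ bernsteinCone := by
  have hpos' : 0 < psi σ b ν (α * ((0 : ℕ) + 1)) := by simpa using hpos
  have hev : ∀ᶠ ε in 𝓝[>] (0 : ℝ),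
      LinGrowth (driftExponent (truncDrift σ b ν ε) (truncMeasure σ ν ε) α) ∧
      eulerLogDeriv (driftExponent (truncDrift σ b ν ε) (truncMeasure σ ν ε) α) ∈
        bernsteinCone := by
    filter_upwards [self_mem_nhdsWithin,
      (tendsto_driftExponent_trunc hσ hν hα 0).eventually_const_lt hpos'] with ε (hε : 0 < ε) h0
    have := isFiniteMeasure_truncMeasure σ hν hε
    exact ⟨driftExponent_linGrowth hα (truncMeasure_ae_pos σ ν hε) h0,
      eulerLogDeriv_driftExponent_mem hα (truncMeasure_ae_pos σ ν hε) h0⟩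
  have hlim := tendsto_driftExponent_trunc (b := b) hσ hν hα
  have hgrow : LinGrowth (fun k : ℕ => psi σ b ν (α * (k + 1))) :=
    LinGrowth.of_tendsto (hev.mono fun _ h => h.1.le) hpos' hlim
  exact ⟨hgrow, isClosed_bernsteinCone.mem_of_tendsto
    (tendsto_eulerLogDeriv (hev.mono fun _ h => h.1) hgrow hlim) (hev.mono fun _ h => h.2)⟩

end LevyMeasure

section PsiPositivity

variable {ν : Measure ℝ}

lemma setIntegral_pos_of_forall_pos {f : ℝ → ℝ} {s : Set ℝ} (hs : MeasurableSet s)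
    (hf : IntegrableOn f s ν) (hpos : ∀ r ∈ s, 0 < f r) (hνs : ν s ≠ 0) :
    0 < ∫ r in s, f r ∂ν := by
  rw [setIntegral_pos_iff_support_of_nonneg_ae
    (ae_restrict_of_forall_mem hs fun r hr => (hpos r hr).le) hf,
    inter_eq_right.2 (show s ⊆ Function.support f from fun r hr => (hpos r hr).ne')]
  exact pos_iff_ne_zero.2 hνs

lemma psi_eq (σ b : ℝ) (ν : Measure ℝ) (u : ℝ) :
    psi σ b ν u = b * u + σ / 2 * u ^ 2 + ∫ r in Ioi (0 : ℝ), psiIntegrand u r ∂ν := rfl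

lemma psi_of_measure_eq_zero (σ b : ℝ) (hν0 : ν (Ioi 0) = 0) (u : ℝ) :
    psi σ b ν u = b * u + σ / 2 * u ^ 2 := by
  rw [psi_eq, Measure.restrict_eq_zero.2 hν0, integral_zero_measure, add_zero]

lemma psi_eq_of_integrableOn (σ b : ℝ)
    (hν : ∫⁻ r in Ioi (0 : ℝ), ENNReal.ofReal (min 1 (r ^ 2)) ∂ν < ⊤) {u : ℝ} (hu : 0 ≤ u)
    (h1 : IntegrableOn (fun r => r) (Ioi 1) ν) :
    IntegrableOn (fun r => exp (-(u * r)) - 1 + u * r) (Ioi 0) ν ∧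
    psi σ b ν u = (b - ∫ r in Ioi (1 : ℝ), r ∂ν) * u + σ / 2 * u ^ 2 +
      ∫ r in Ioi (0 : ℝ), (exp (-(u * r)) - 1 + u * r) ∂ν := by
  have hsub : Ioi (1 : ℝ) ⊆ Ioi 0 := Ioi_subset_Ioi zero_le_one
  have hint := integrableOn_psiIntegrand hν hu
  have hind : IntegrableOn ((Ioi (1 : ℝ)).indicator fun r => u * r) (Ioi 0) ν :=
    (IntegrableOn.integrable_indicator (h1.const_mul u) measurableSet_Ioi).integrableOn
  have heq : (fun r => exp (-(u * r)) - 1 + u * r) =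
      fun r => psiIntegrand u r + (Ioi (1 : ℝ)).indicator (fun r => u * r) r := by
    ext r
    by_cases h : r ≤ 1
    · rw [indicator_of_notMem (by simpa using h)]
      simp [psiIntegrand, h]
    · rw [indicator_of_mem (by simpa using h)]
      simp [psiIntegrand, h]
  rw [heq]
  refine ⟨hint.add hind, ?_⟩
  rw [integral_add hint hind, setIntegral_indicator measurableSet_Ioi, inter_eq_right.2 hsub,
    integral_const_mul, psi_eq]
  ring

lemma psi_pos_of_mean_nonneg {σ b : ℝ} (hσ : 0 ≤ σ)
    (hν : ∫⁻ r in Ioi (0 : ℝ), ENNReal.ofReal (min 1 (r ^ 2)) ∂ν < ⊤)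
    (hnd : 0 < σ ∨ ν (Ioi 0) ≠ 0 ∨ b ≠ 0) {u : ℝ} (hu : 0 < u)
    (h1 : IntegrableOn (fun r => r) (Ioi 1) ν) (hm : 0 ≤ b - ∫ r in Ioi (1 : ℝ), r ∂ν) :
    0 < psi σ b ν u := by
  obtain ⟨hint, heq⟩ := psi_eq_of_integrableOn σ b hν hu.le h1
  have hJ : 0 ≤ ∫ r in Ioi (0 : ℝ), (exp (-(u * r)) - 1 + u * r) ∂ν :=
    integral_nonneg fun r => exp_neg_sub_one_add_nonneg _
  have hd : 0 ≤ (b - ∫ r in Ioi (1 : ℝ), r ∂ν) * u := by positivity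
  have hq : 0 ≤ σ / 2 * u ^ 2 := by positivity
  by_cases hν0 : ν (Ioi 0) = 0
  · have hν1 : ν.restrict (Ioi 1) = 0 :=
      Measure.restrict_eq_zero.2 (measure_mono_null (Ioi_subset_Ioi zero_le_one) hν0)
    rw [hν1, integral_zero_measure, sub_zero] at hm
    rw [psi_of_measure_eq_zero _ _ hν0]
    rcases hnd with h | h | h
    · positivity
    · exact absurd hν0 h
    · have : 0 < b := lt_of_le_of_ne hm h.symm
      positivity
  · have := setIntegral_pos_of_forall_pos measurableSet_Ioi hint (fun r (hr : 0 < r) => by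
      have := add_one_lt_exp (x := -(u * r)) (neg_ne_zero.2 (by positivity))
      linarith) hν0
    rw [heq]
    linarith

lemma mul_psiIntegrand_lt {θ α r : ℝ} (hθ : 0 < θ) (hθα : θ < α) (hr : 0 < r) :
    α * psiIntegrand θ r < θ * psiIntegrand α r := by
  have hα : 0 < α := hθ.trans hθα
  have h := strictConvexOn_exp.2 (mem_univ (-α * r)) (mem_univ 0)
    (by rw [neg_mul]; exact neg_ne_zero.2 (by positivity)) (div_pos hθ hα)
    (sub_pos.2 ((div_lt_one hα).2 hθα)) (add_sub_cancel _ _)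
  simp only [smul_eq_mul, mul_zero, add_zero, exp_zero, mul_one] at h
  rw [show θ / α * (-α * r) = -θ * r by field_simp] at h
  have h' : α * exp (-θ * r) < θ * exp (-α * r) + (α - θ) := by
    calc α * exp (-θ * r) < α * (θ / α * exp (-α * r) + (1 - θ / α)) := by gcongr
      _ = _ := by field_simp
  unfold psiIntegrand
  split_ifs <;> nlinarith

lemma psi_pos_of_root {σ b : ℝ} (hσ : 0 ≤ σ)
    (hν : ∫⁻ r in Ioi (0 : ℝ), ENNReal.ofReal (min 1 (r ^ 2)) ∂ν < ⊤)
    (hnd : 0 < σ ∨ ν (Ioi 0) ≠ 0 ∨ b ≠ 0) {θ α : ℝ} (hθ : 0 < θ) (hθα : θ < α)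
    (hroot : psi σ b ν θ = 0) : 0 < psi σ b ν α := by
  have hα : 0 < α := hθ.trans hθα
  by_cases hν0 : ν (Ioi 0) = 0
  · rw [psi_of_measure_eq_zero _ _ hν0] at hroot ⊢
    have h2 : b + σ / 2 * θ = 0 := by
      have : (b + σ / 2 * θ) * θ = 0 := by linear_combination hroot
      exact (mul_eq_zero.1 this).resolve_right hθ.ne'
    have hσ0 : 0 < σ := by
      rcases hnd with h | h | h
      · exact h
      · exact absurd hν0 h
      · refine lt_of_le_of_ne hσ fun h0 => h ?_
        rw [← h0] at h2
        linarith
    have : b * α + σ / 2 * α ^ 2 = σ / 2 * (α - θ) * α := by linear_combination α * h2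
    rw [this]
    have : 0 < α - θ := sub_pos.2 hθα
    positivity
  · have hi1 := integrableOn_psiIntegrand hν hα.le
    have hi2 := integrableOn_psiIntegrand hν hθ.le
    have h := setIntegral_pos_of_forall_pos measurableSet_Ioi
      ((hi1.const_mul θ).sub (hi2.const_mul α))
      (fun r hr => sub_pos.2 (mul_psiIntegrand_lt hθ hθα hr)) hν0
    simp only [Pi.sub_apply] at h
    rw [integral_sub (hi1.const_mul θ) (hi2.const_mul α), integral_const_mul,
      integral_const_mul] at h
    rw [psi_eq] at hroot ⊢
    have hgap : 0 ≤ σ / 2 * (α * θ * (α - θ)) := by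
      have : 0 < α - θ := sub_pos.2 hθα
      positivity
    refine pos_of_mul_pos_right (a := θ) ?_ hθ.le
    nlinarith

end PsiPositivity

section LevyDensity

variable {p : ℕ → ℝ}

lemma hasDerivAt_recipSeries (hp : LinGrowth p) (x : ℝ) :
    HasDerivAt (recipSeries p) (∑' n : ℕ, (n : ℝ) * (recipProd p n * x ^ (n - 1))) x := by
  set R : ℝ := |x| + 1 with hR
  have hR1 : 1 ≤ R := by rw [hR]; linarith [abs_nonneg x]
  have hsum := summable_weighted_recipProd hp abs_natCast_le_two_pow R
  have h := hasDerivAt_tsum_of_isPreconnected (𝕜 := ℝ) (g := fun n y => recipProd p n * y ^ n)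
    (g' := fun n y => (n : ℝ) * (recipProd p n * y ^ (n - 1))) (t := Metric.ball 0 R) (y₀ := 0)
    (y := x) hsum
    Metric.isOpen_ball (convex_ball _ _).isPreconnected
    (fun n y _ => by
      refine ((hasDerivAt_pow n y).const_mul (recipProd p n)).congr_deriv ?_
      ring)
    (fun n y hy => by
      have hy' : |y| ≤ R := by simpa using (Metric.mem_ball.1 hy).le
      rw [norm_eq_abs, abs_mul, abs_mul, abs_of_pos (recipProd_pos hp n), abs_pow, Nat.abs_cast]
      have := (recipProd_pos hp n).le
      gcongr
      calc |y| ^ (n - 1) ≤ R ^ (n - 1) := by gcongr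
        _ ≤ R ^ n := pow_le_pow_right₀ hR1 (Nat.sub_le _ _))
    (by simp [hR]; positivity) (hasSum_recipSeries hp 0).summable (by simp [hR])
  exact h

lemma hasDerivAt_log_recipSeries (hp : LinGrowth p) (q : NNReal) {t : ℝ} (ht : 0 < t) :
    HasDerivAt (fun t => log (recipSeries p (q * t)))
      (eulerLogDeriv p (q * t.toNNReal) / t) t := by
  have hpos : 0 < recipSeries p (q * t) :=
    zero_lt_one.trans_le (one_le_recipSeries hp (by positivity))
  have h1 : HasDerivAt (fun t : ℝ => (q : ℝ) * t) q t := by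
    simpa using (hasDerivAt_id t).const_mul (q : ℝ)
  have h2 := ((hasDerivAt_recipSeries hp (q * t)).comp t h1).log hpos.ne'
  refine h2.congr_deriv ?_
  rw [eulerLogDeriv, NNReal.coe_mul, Real.coe_toNNReal _ ht.le, div_right_comm]
  congr 1
  rw [← tsum_mul_right, ← tsum_div_const]
  refine tsum_congr fun n => ?_
  rcases n with _ | n
  · simp
  · rw [Nat.add_sub_cancel, pow_succ]
    field_simp

lemma eulerLogDeriv_nonneg (hp : LinGrowth p) (q : NNReal) : 0 ≤ eulerLogDeriv p q :=
  div_nonneg (tsum_nonneg fun n => mul_nonneg n.cast_nonneg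
    (mul_nonneg (recipProd_pos hp n).le (pow_nonneg q.2 n)))
    (zero_le_one.trans (one_le_recipSeries hp q.2))

lemma eulerLogDeriv_le (hp : LinGrowth p) {q : NNReal} (hq : q ≤ 1) :
    eulerLogDeriv p q ≤ q * ∑' n : ℕ, (n : ℝ) * recipProd p n := by
  have hs := summable_weighted_recipProd hp abs_natCast_le_two_pow q
  have hs1 := summable_weighted_recipProd hp abs_natCast_le_two_pow 1
  simp only [one_pow, mul_one] at hs1
  refine (div_le_self (tsum_nonneg fun n => mul_nonneg n.cast_nonneg
    (mul_nonneg (recipProd_pos hp n).le (pow_nonneg q.2 n))) (one_le_recipSeries hp q.2)).trans ?_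
  rw [← tsum_mul_left]
  refine hs.tsum_le_tsum (fun n => ?_) (hs1.mul_left _)
  rcases n with _ | n
  · simp
  · have h1 : (q : ℝ) ^ n ≤ 1 := pow_le_one₀ q.2 (by exact_mod_cast hq)
    have h2 : 0 ≤ ((n + 1 : ℕ) : ℝ) * recipProd p (n + 1) * q :=
      mul_nonneg (mul_nonneg (Nat.cast_nonneg _) (recipProd_pos hp _).le) q.2
    calc ((n + 1 : ℕ) : ℝ) * (recipProd p (n + 1) * (q : ℝ) ^ (n + 1))
        = ((n + 1 : ℕ) : ℝ) * recipProd p (n + 1) * q * (q : ℝ) ^ n := by ring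
      _ ≤ ((n + 1 : ℕ) : ℝ) * recipProd p (n + 1) * q * 1 := by gcongr
      _ = _ := by ring

lemma lintegral_eulerLogDeriv_div (hp : LinGrowth p) (q : NNReal) :
    ∫⁻ t in Ioc (0 : ℝ) 1, ENNReal.ofReal (eulerLogDeriv p (q * t.toNNReal) / t) =
      ENNReal.ofReal (log (recipSeries p q)) := by
  have hcont : ContinuousOn (fun t : ℝ => log (recipSeries p (q * t))) (Icc 0 1) := by
    have h1 : Continuous (recipSeries p) :=
      continuous_iff_continuousAt.2 fun x => (hasDerivAt_recipSeries hp x).continuousAt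
    refine ContinuousOn.log (by fun_prop) fun t ht => ?_
    exact (zero_lt_one.trans_le (one_le_recipSeries hp (mul_nonneg q.2 ht.1))).ne'
  have hderiv : ∀ t ∈ Ioo (0 : ℝ) 1, HasDerivAt (fun t : ℝ => log (recipSeries p (q * t)))
      (eulerLogDeriv p (q * t.toNNReal) / t) t :=
    fun t ht => hasDerivAt_log_recipSeries hp q ht.1
  have hnn : ∀ t : ℝ, 0 < t → 0 ≤ eulerLogDeriv p (q * t.toNNReal) / t :=
    fun t ht => div_nonneg (eulerLogDeriv_nonneg hp _) ht.le
  have hint := intervalIntegral.integrableOn_deriv_of_nonneg hcont hderiv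
    fun t ht => hnn t ht.1
  have hftc := intervalIntegral.integral_eq_sub_of_hasDerivAt_of_le zero_le_one hcont hderiv
    ((intervalIntegrable_iff_integrableOn_Ioc_of_le zero_le_one).2 hint)
  rw [intervalIntegral.integral_of_le zero_le_one, mul_one, mul_zero, recipSeries_zero, log_one,
    sub_zero] at hftc
  rw [← hftc, ofReal_integral_eq_lintegral_ofReal hint
    (ae_restrict_of_forall_mem measurableSet_Ioc fun t ht => hnn t ht.1)]

lemma measure_zero_singleton_of_eulerLogDeriv (hp : LinGrowth p) {M : FiniteMeasure unitInterval}
    (hM : ∀ q, eulerLogDeriv p q = ∫ x, lkKernel q x ∂(M : Measure unitInterval)) :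
    (M : Measure unitInterval) {0} = 0 := by
  have hle : ∀ q : NNReal, 0 < q → q ≤ 1 →
      (M : Measure unitInterval).real {0} ≤ q * ∑' n : ℕ, (n : ℝ) * recipProd p n := by
    intro q hq0 hq1
    refine le_trans ?_ (eulerLogDeriv_le hp hq1)
    rw [hM q]
    have h1 : ∫ x in ({0} : Set unitInterval), lkKernel q x ∂(M : Measure unitInterval) =
        (M : Measure unitInterval).real {0} := by
      rw [integral_singleton]
      have : (0 : ℝ) ^ (q : ℝ) = 0 := zero_rpow (by exact_mod_cast hq0.ne')
      simp [lkKernel_of_ne q zero_ne_one, this]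
    rw [← h1]
    exact setIntegral_le_integral (integrable_lkKernel q M)
      (Eventually.of_forall fun x => lkKernel_nonneg q x.2.1 x.2.2)
  have hlim : Tendsto (fun q : NNReal => (q : ℝ) * ∑' n : ℕ, (n : ℝ) * recipProd p n) (𝓝[>] 0)
      (𝓝 0) := by
    have : Tendsto (fun q : NNReal => (q : ℝ) * ∑' n : ℕ, (n : ℝ) * recipProd p n) (𝓝 0)
        (𝓝 (((0 : NNReal) : ℝ) * ∑' n : ℕ, (n : ℝ) * recipProd p n)) := by
      apply Continuous.tendsto
      fun_prop
    rw [NNReal.coe_zero, zero_mul] at this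
    exact this.mono_left nhdsWithin_le_nhds
  have h0 : (M : Measure unitInterval).real {0} ≤ 0 := by
    refine ge_of_tendsto hlim ?_
    filter_upwards [Ioc_mem_nhdsGT (zero_lt_one (α := NNReal))] with q hq
    exact hle q hq.1 hq.2
  exact (measureReal_eq_zero_iff).1 (le_antisymm h0 measureReal_nonneg)

/-- The weight `1 / (1 - x)` on `{x < exp (-r)}`: the contribution of jumps of size `-log x` to the
tail at `r`. -/
noncomputable def tailWeight (x : unitInterval) (r : ℝ) : ENNReal :=
  if (x : ℝ) < exp (-r) then ENNReal.ofReal (1 / (1 - x)) else 0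

lemma measurable_tailWeight : Measurable (fun z : unitInterval × ℝ => tailWeight z.1 z.2) := by
  unfold tailWeight
  exact Measurable.ite (measurableSet_lt (by fun_prop) (by fun_prop)) (by fun_prop) (by fun_prop)

lemma tailWeight_antitone (x : unitInterval) : Antitone (tailWeight x) := by
  intro r s hrs
  unfold tailWeight
  by_cases h : (x : ℝ) < exp (-s)
  · rw [if_pos h, if_pos (h.trans_le (exp_le_exp.2 (neg_le_neg hrs)))]
  · rw [if_neg h]
    exact zero_le

lemma tailWeight_le (x : unitInterval) {r : ℝ} (hr : 0 < r) :
    tailWeight x r ≤ ENNReal.ofReal (1 / (1 - exp (-r))) := by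
  unfold tailWeight
  split_ifs with h
  · have : exp (-r) < 1 := by
      rw [← exp_zero]
      exact exp_lt_exp.2 (by linarith)
    refine ENNReal.ofReal_le_ofReal (one_div_le_one_div_of_le (by linarith) (by linarith))
  · exact zero_le

/-- The tail of the image of `1 / (1 - x) M(dx)` under `x ↦ -log x`. -/
noncomputable def levyTail (M : Measure unitInterval) (r : ℝ) : ENNReal := ∫⁻ x, tailWeight x r ∂M

lemma levyTail_antitone (M : Measure unitInterval) : Antitone (levyTail M) :=
  fun _ _ h => lintegral_mono fun x => tailWeight_antitone x h

lemma levyTail_lt_top (M : Measure unitInterval) [IsFiniteMeasure M] {r : ℝ} (hr : 0 < r) :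
    levyTail M r < ⊤ := by
  refine (lintegral_mono fun x => tailWeight_le x hr).trans_lt ?_
  rw [lintegral_const]
  exact ENNReal.mul_lt_top ENNReal.ofReal_lt_top (measure_lt_top _ _)

lemma lintegral_lkKernel_div (q : NNReal) {x : unitInterval} (hx : x ≠ 0) :
    ∫⁻ t in Ioc (0 : ℝ) 1, ENNReal.ofReal (lkKernel (q * t.toNNReal) x / t) =
      ({1} : Set unitInterval).indicator (fun _ => (q : ENNReal)) x +
        ∫⁻ r in Ioi (0 : ℝ), ENNReal.ofReal ((1 - exp (-q * r)) / r) * tailWeight x r := by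
  rw [Measure.restrict_congr_set Ioo_ae_eq_Ioc.symm]
  rcases eq_or_ne x 1 with rfl | hx1
  · have h1 : ∫⁻ r in Ioi (0 : ℝ), ENNReal.ofReal ((1 - exp (-q * r)) / r) * tailWeight 1 r = 0 := by
      rw [← lintegral_zero (μ := volume.restrict (Ioi (0 : ℝ)))]
      refine setLIntegral_congr_fun measurableSet_Ioi fun r (hr : 0 < r) => ?_
      have : ¬ (1 : ℝ) < exp (-r) := not_lt.2 (exp_le_one_iff.2 (by linarith))
      simp [tailWeight, this]
    have h2 : ∫⁻ t in Ioo (0 : ℝ) 1, ENNReal.ofReal (lkKernel (q * t.toNNReal) (1 : unitInterval) / t)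
        = ∫⁻ _ in Ioo (0 : ℝ) 1, (q : ENNReal) := by
      refine setLIntegral_congr_fun measurableSet_Ioo fun t ht => ?_
      rw [Icc.coe_one, lkKernel_one, NNReal.coe_mul, Real.coe_toNNReal _ ht.1.le,
        mul_div_cancel_right₀ _ ht.1.ne', ENNReal.ofReal_coe_nnreal]
    rw [h1, h2, indicator_of_mem (mem_singleton _), add_zero, lintegral_const]
    simp
  · have hx0' : (0 : ℝ) < x := unitInterval.pos_iff_ne_zero.2 hx
    have hx1' : (x : ℝ) < 1 := unitInterval.lt_one_iff_ne_one.2 hx1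
    set y : ℝ := -log x with hy
    have hy0 : 0 < y := neg_pos.2 (log_neg hx0' hx1')
    have hxy : (x : ℝ) = exp (-y) := by rw [hy, neg_neg, exp_log hx0']
    have himg : (fun t : ℝ => t * y) '' Ioo 0 1 = Ioo 0 y := by
      rw [image_mul_right_Ioo _ _ hy0, zero_mul, one_mul]
    have hcov := lintegral_image_eq_lintegral_abs_deriv_mul (measurableSet_Ioo (a := (0:ℝ)) (b := 1))
      (f := fun t : ℝ => t * y) (f' := fun _ => y)
      (fun t _ => (hasDerivAt_mul_const y).hasDerivWithinAt)
      (mul_left_injective₀ hy0.ne').injOn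
      (fun r => ENNReal.ofReal ((1 - exp (-q * r)) / r) * ENNReal.ofReal (1 / (1 - x)))
    have hright : ∫⁻ r in Ioi (0 : ℝ), ENNReal.ofReal ((1 - exp (-q * r)) / r) * tailWeight x r =
        ∫⁻ r in Ioo 0 y, ENNReal.ofReal ((1 - exp (-q * r)) / r) * ENNReal.ofReal (1 / (1 - x)) := by
      rw [← inter_eq_left.2 (Ioo_subset_Ioi_self : Ioo 0 y ⊆ Ioi 0),
        ← setLIntegral_indicator measurableSet_Ioo]
      refine setLIntegral_congr_fun measurableSet_Ioi fun r (hr : 0 < r) => ?_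
      have hiff : (x : ℝ) < exp (-r) ↔ r ∈ Ioo 0 y := by
        rw [hxy, exp_lt_exp, neg_lt_neg_iff, mem_Ioo]
        exact ⟨fun h => ⟨hr, h⟩, fun h => h.2⟩
      by_cases h : r ∈ Ioo 0 y
      · rw [indicator_of_mem h, tailWeight, if_pos (hiff.2 h)]
      · rw [indicator_of_notMem h, tailWeight, if_neg (mt hiff.1 h), mul_zero]
    rw [indicator_of_notMem (mt mem_singleton_iff.1 hx1), zero_add, hright, ← himg, hcov]
    refine setLIntegral_congr_fun measurableSet_Ioo fun t ht => ?_
    have ht0 : 0 < t := ht.1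
    have hpow : (x : ℝ) ^ ((q * t.toNNReal : NNReal) : ℝ) = exp (-q * (t * y)) := by
      rw [hxy, ← exp_mul, NNReal.coe_mul, Real.coe_toNNReal _ ht0.le]
      ring_nf
    have hnn : 0 ≤ (1 - exp (-q * (t * y))) / (t * y) := by
      refine div_nonneg (sub_nonneg.2 (exp_le_one_iff.2 ?_)) (by positivity)
      rw [neg_mul, neg_nonpos]
      positivity
    have h1x : 1 - (x : ℝ) ≠ 0 := (sub_pos.2 hx1').ne'
    rw [lkKernel_of_ne _ hx1'.ne, hpow, ← ENNReal.ofReal_mul hnn, ← ENNReal.ofReal_mul (abs_nonneg _),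
      abs_of_pos hy0]
    congr 1
    field_simp

lemma measurable_lkKernel_mul_div (q : NNReal) :
    Measurable fun z : ℝ × unitInterval =>
      ENNReal.ofReal (lkKernel (q * z.1.toNNReal) z.2 / z.1) := by
  have h : (fun z : ℝ × unitInterval => lkKernel (q * z.1.toNNReal) z.2) = fun z =>
      if (z.2 : ℝ) = 1 then ((q * z.1.toNNReal : NNReal) : ℝ)
        else (1 - (z.2 : ℝ) ^ ((q * z.1.toNNReal : NNReal) : ℝ)) / (1 - z.2) := by
    ext z
    split_ifs with hz
    · rw [hz, lkKernel_one]
    · rw [lkKernel_of_ne _ hz]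
  have hm : Measurable fun z : ℝ × unitInterval => lkKernel (q * z.1.toNNReal) z.2 := by
    rw [h]
    refine Measurable.ite (measurableSet_eq_fun (by fun_prop) (by fun_prop)) (by fun_prop) ?_
    fun_prop
  fun_prop

lemma ofReal_log_recipSeries (hp : LinGrowth p) {M : FiniteMeasure unitInterval}
    (hM : ∀ q, eulerLogDeriv p q = ∫ x, lkKernel q x ∂(M : Measure unitInterval)) (q : NNReal) :
    ENNReal.ofReal (log (recipSeries p q)) = q * (M : Measure unitInterval) {1} +
      ∫⁻ r in Ioi (0 : ℝ), ENNReal.ofReal ((1 - exp (-q * r)) / r) *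
        levyTail (M : Measure unitInterval) r := by
  have hne : ∀ᵐ x ∂(M : Measure unitInterval), x ≠ 0 := by
    rw [ae_iff]
    simpa using measure_zero_singleton_of_eulerLogDeriv hp hM
  have hmeas : Measurable fun z : unitInterval × ℝ =>
      ENNReal.ofReal ((1 - exp (-q * z.2)) / z.2) * tailWeight z.1 z.2 :=
    Measurable.mul (by fun_prop) measurable_tailWeight
  calc ENNReal.ofReal (log (recipSeries p q))
      = ∫⁻ t in Ioc (0 : ℝ) 1, ∫⁻ x, ENNReal.ofReal (lkKernel (q * t.toNNReal) x / t)
          ∂(M : Measure unitInterval) := by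
        rw [← lintegral_eulerLogDeriv_div hp q]
        refine setLIntegral_congr_fun measurableSet_Ioc fun t ht => ?_
        rw [hM, ← integral_div, ofReal_integral_eq_lintegral_ofReal
          ((integrable_lkKernel _ M).div_const t)
          (Eventually.of_forall fun x => div_nonneg (lkKernel_nonneg _ x.2.1 x.2.2) ht.1.le)]
    _ = ∫⁻ x : unitInterval, (∫⁻ t in Ioc (0 : ℝ) 1,
          ENNReal.ofReal (lkKernel (q * t.toNNReal) x / t))
          ∂(M : Measure unitInterval) :=
        lintegral_lintegral_swap (measurable_lkKernel_mul_div q).aemeasurable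
    _ = ∫⁻ x, (({1} : Set unitInterval).indicator (fun _ => (q : ENNReal)) x +
        ∫⁻ r in Ioi (0 : ℝ), ENNReal.ofReal ((1 - exp (-q * r)) / r) * tailWeight x r)
          ∂(M : Measure unitInterval) :=
        lintegral_congr_ae (hne.mono fun x hx => lintegral_lkKernel_div q hx)
    _ = _ := by
        rw [lintegral_add_left (measurable_const.indicator (measurableSet_singleton _)),
          lintegral_indicator_const (measurableSet_singleton _),
          lintegral_lintegral_swap hmeas.aemeasurable]
        congr 1
        refine lintegral_congr fun r => ?_
        exact lintegral_const_mul _ (measurable_tailWeight.comp measurable_prodMk_right)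

lemma min_one_le_two_mul_one_sub_exp {r : ℝ} (hr : 0 ≤ r) : min 1 r ≤ 2 * (1 - exp (-r)) := by
  have h : exp (-r) * (1 + r) ≤ 1 := by
    calc exp (-r) * (1 + r) ≤ exp (-r) * exp r := by
          gcongr
          linarith [add_one_le_exp r]
      _ = 1 := by rw [← exp_add]; simp
  rcases le_total r 1 with h1 | h1
  · rw [min_eq_right h1]
    nlinarith [exp_pos (-r)]
  · rw [min_eq_left h1]
    nlinarith [exp_pos (-r)]

lemma exists_selfDecomposable_of_mem_bernsteinCone (hp : LinGrowth p)
    (hmem : eulerLogDeriv p ∈ bernsteinCone) :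
    ∃ a : ℝ, 0 ≤ a ∧ ∃ k : ℝ → ℝ,
      (∀ r : ℝ, 0 < r → 0 ≤ k r) ∧ AntitoneOn k (Ioi 0) ∧
      IntegrableOn (fun r => min 1 r * (k r / r)) (Ioi 0) volume ∧
      ∀ q : ℝ, 0 ≤ q →
        1 / recipSeries p q =
          exp (-(a * q + ∫ r in Ioi (0 : ℝ), (1 - exp (-q * r)) * (k r / r))) := by
  obtain ⟨M, hM⟩ := hmem
  set k : ℝ → ℝ := fun r => (levyTail (M : Measure unitInterval) r).toReal with hk
  have hk0 : ∀ r, 0 ≤ k r := fun r => ENNReal.toReal_nonneg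
  have hkmeas : Measurable k := (levyTail_antitone _).measurable.ennreal_toReal
  have hnn : ∀ q : NNReal, ∀ r ∈ Ioi (0 : ℝ), 0 ≤ (1 - exp (-q * r)) * (k r / r) := by
    intro q r (hr : 0 < r)
    refine mul_nonneg (sub_nonneg.2 (exp_le_one_iff.2 ?_)) (div_nonneg (hk0 r) hr.le)
    rw [neg_mul, neg_nonpos]
    positivity
  have hlint : ∀ q : NNReal, ENNReal.ofReal (log (recipSeries p q)) =
      ENNReal.ofReal ((M : Measure unitInterval).real {1} * q) +
        ∫⁻ r in Ioi (0 : ℝ), ENNReal.ofReal ((1 - exp (-q * r)) * (k r / r)) := by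
    intro q
    rw [ofReal_log_recipSeries hp hM q, mul_comm, ENNReal.ofReal_mul measureReal_nonneg,
      ofReal_measureReal, ENNReal.ofReal_coe_nnreal]
    congr 1
    refine setLIntegral_congr_fun measurableSet_Ioi fun r (hr : 0 < r) => ?_
    have hq : 0 ≤ (1 - exp (-q * r)) / r := by
      refine div_nonneg (sub_nonneg.2 (exp_le_one_iff.2 ?_)) hr.le
      rw [neg_mul, neg_nonpos]
      positivity
    rw [← mul_div_assoc, mul_div_right_comm, ENNReal.ofReal_mul hq,
      ENNReal.ofReal_toReal (levyTail_lt_top _ hr).ne]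
  have hint : ∀ q : NNReal,
      IntegrableOn (fun r => (1 - exp (-q * r)) * (k r / r)) (Ioi 0) volume := by
    intro q
    refine ⟨by fun_prop, ?_⟩
    rw [hasFiniteIntegral_iff_ofReal (ae_restrict_of_forall_mem measurableSet_Ioi (hnn q))]
    refine lt_of_le_of_lt ?_ (ENNReal.ofReal_lt_top (r := log (recipSeries p q)))
    rw [hlint q]
    exact le_add_self
  refine ⟨(M : Measure unitInterval).real {1}, measureReal_nonneg, k, fun r _ => hk0 r, ?_, ?_, ?_⟩
  · intro r hr s _ hrs
    exact ENNReal.toReal_mono (levyTail_lt_top _ hr).ne (levyTail_antitone _ hrs)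
  · refine ((hint 1).const_mul 2).mono' (by fun_prop) ?_
    refine ae_restrict_of_forall_mem measurableSet_Ioi fun r (hr : 0 < r) => ?_
    have h1 := min_one_le_two_mul_one_sub_exp hr.le
    have h2 : 0 ≤ k r / r := div_nonneg (hk0 r) hr.le
    rw [norm_eq_abs, abs_of_nonneg (mul_nonneg (le_min zero_le_one hr.le) h2), ← mul_assoc,
      NNReal.coe_one, neg_one_mul]
    gcongr
  · intro q hq
    lift q to NNReal using hq
    have h1 : 1 ≤ recipSeries p (q : ℝ) := one_le_recipSeries hp q.2
    have h2 := hlint q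
    have hA : 0 ≤ (M : Measure unitInterval).real {1} * q := by positivity
    have hJ : 0 ≤ ∫ r in Ioi (0 : ℝ), (1 - exp (-q * r)) * (k r / r) :=
      setIntegral_nonneg measurableSet_Ioi (hnn q)
    rw [← ofReal_integral_eq_lintegral_ofReal (hint q)
      (ae_restrict_of_forall_mem measurableSet_Ioi (hnn q)),
      ← ENNReal.ofReal_add hA hJ,
      ENNReal.ofReal_eq_ofReal_iff (log_nonneg h1) (add_nonneg hA hJ)] at h2
    rw [← h2, exp_neg, exp_log (zero_lt_one.trans_le h1), one_div]

end LevyDensity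

/-- Theorem 2.4, self-decomposability: `q ↦ 1/I_{α,ψ}(q)` is the Laplace transform of a
self-decomposable probability distribution on `[0,∞)`. -/
theorem Ifun_inv_self_decomposable (σ b : ℝ) (ν : Measure ℝ)
    (hσ : 0 ≤ σ)
    (hν : ∫⁻ r in Ioi (0 : ℝ), ENNReal.ofReal (min 1 (r ^ 2)) ∂ν < ⊤)
    (hnd : 0 < σ ∨ ν (Ioi 0) ≠ 0 ∨ b ≠ 0)
    (hns : 0 < σ ∨ ¬ IntegrableOn (fun r => r) (Ioc 0 1) ν ∨
      0 < b - ∫ r in Ioc (0 : ℝ) 1, r ∂ν)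
    (α : ℝ) (hα : 0 < α)
    (hcase : (IntegrableOn (fun r => r) (Ioi 1) ν ∧ 0 ≤ b - ∫ r in Ioi (1 : ℝ), r ∂ν) ∨
      ((¬ IntegrableOn (fun r => r) (Ioi 1) ν ∨ b - ∫ r in Ioi (1 : ℝ), r ∂ν < 0) ∧
        ∃ θ : ℝ, 0 < θ ∧ psi σ b ν θ = 0 ∧ θ < α)) :
    ∃ a : ℝ, 0 ≤ a ∧ ∃ k : ℝ → ℝ,
      (∀ r : ℝ, 0 < r → 0 ≤ k r) ∧ AntitoneOn k (Ioi 0) ∧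
      IntegrableOn (fun r => min 1 r * (k r / r)) (Ioi 0) volume ∧
      ∀ q : ℝ, 0 ≤ q →
        1 / Iser (psi σ b ν) α q =
          Real.exp (-(a * q + ∫ r in Ioi (0 : ℝ), (1 - Real.exp (-q * r)) * (k r / r))) := by
  have hpos : 0 < psi σ b ν α := by
    rcases hcase with ⟨h1, hm⟩ | ⟨-, θ, hθ, hroot, hθα⟩
    · exact psi_pos_of_mean_nonneg hσ hν hnd hα h1 hm
    · exact psi_pos_of_root hσ hν hnd hθ hθα hroot
  obtain ⟨hgrow, hmem⟩ := psi_linGrowth_and_mem hσ hν hα hpos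
  exact exists_selfDecomposable_of_mem_bernsteinCone hgrow hmem
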